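/- arXiv:math/0509441 — 4 statements merged into one kernel-verified Lean document; each statement's English description precedes it below -/
import Mathlib

section
/- Let n ≥ 2, let A be a fixed n × n matrix over ℝ with tr(AAᵀ) = n, let M be a random matrix in the orthogonal group O(n) distributed according to Haar (probability) measure, and let W = tr(AM). Let Z be a standard normal random variable. Then the total variation distance between the law of W and the law of Z satisfies d_TV(W, Z) ≤ 2√3/(n − 1). -/
open MeasureTheory ProbabilityTheory Matrix

noncomputable instance {n : ℕ} : MeasurableSpace (Matrix.orthogonalGroup (Fin n) ℝ) :=
  borel _

instance {n : ℕ} : BorelSpace (Matrix.orthogonalGroup (Fin n) ℝ) := ⟨rfl⟩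

theorem aux_integrable_tg : Integrable (fun t : ℝ => t * Real.exp (-t^2/2)) := by
  have := integrable_mul_exp_neg_mul_sq (b := 1/2) (by norm_num)
  refine this.congr (ae_of_all _ fun t => ?_)
  simp only; congr 2; ring

theorem aux_integrable_g : Integrable (fun t : ℝ => Real.exp (-t^2/2)) := by
  have := integrable_exp_neg_mul_sq (b := 1/2) (by norm_num)
  refine this.congr (ae_of_all _ fun t => ?_)
  simp only; congr 1; ring

theorem aux_deriv_g (x : ℝ) :
    HasDerivAt (fun t : ℝ => -Real.exp (-t^2/2)) (x * Real.exp (-x^2/2)) x := by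
  have h : HasDerivAt (fun t : ℝ => -t^2/2) (-x) x := by
    exact ((hasDerivAt_pow 2 x).neg.div_const 2).congr_deriv (by simp; ring)
  exact h.exp.neg.congr_deriv (by ring)

theorem aux_tendsto_g : Filter.Tendsto (fun t : ℝ => -Real.exp (-t^2/2)) (Filter.cocompact ℝ) (nhds 0) := by
  have h1 : Filter.Tendsto (fun t : ℝ => -t^2/2) (Filter.cocompact ℝ) Filter.atBot := by
    have : Filter.Tendsto (fun t : ℝ => ‖t‖) (Filter.cocompact ℝ) Filter.atTop :=
      tendsto_norm_cocompact_atTop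
    have h2 := (Filter.tendsto_pow_atTop (α := ℝ) (n := 2) two_ne_zero).comp this
    have h3 := Filter.tendsto_neg_atTop_atBot.comp (h2.atTop_div_const (r := 2) (by norm_num))
    refine h3.congr fun t => ?_
    simp [neg_div]
  simpa using (Real.tendsto_exp_atBot.comp h1).neg

theorem aux_tail_pos (x : ℝ) : ∫ t in Set.Ioi x, t * Real.exp (-t^2/2) = Real.exp (-x^2/2) := by
  have := integral_Ioi_of_hasDerivAt_of_tendsto' (a := x) (fun y _ => aux_deriv_g y)
    aux_integrable_tg.integrableOn
    (aux_tendsto_g.mono_left (by rw [cocompact_eq_atBot_atTop]; exact le_sup_right))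
  rw [this]; ring

theorem aux_tail_neg (x : ℝ) : ∫ t in Set.Iic x, t * Real.exp (-t^2/2) = -Real.exp (-x^2/2) := by
  have := integral_Iic_of_hasDerivAt_of_tendsto' (a := x) (fun y _ => aux_deriv_g y)
    aux_integrable_tg.integrableOn
    (aux_tendsto_g.mono_left (by rw [cocompact_eq_atBot_atTop]; exact le_sup_left))
  rw [this]; ring

theorem aux_mean (h : ℝ → ℝ) : ∫ y, h y ∂gaussianReal 0 1
    = (Real.sqrt (2 * Real.pi))⁻¹ * ∫ t, h t * Real.exp (-t^2/2) := by
  rw [integral_gaussianReal_eq_integral_smul one_ne_zero, ← integral_const_mul]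
  congr 1; ext t
  simp [gaussianPDFReal]; ring

theorem stein_solution (h : ℝ → ℝ) (hc : Continuous h) (h0 : ∀ x, 0 ≤ h x) (h1 : ∀ x, h x ≤ 1) :
    ∃ f f' : ℝ → ℝ, Continuous f' ∧ (∀ x, HasDerivAt f (f' x) x) ∧
      (∀ x, f' x - x * f x = h x - ∫ y, h y ∂gaussianReal 0 1) ∧ ∀ x, |f' x| ≤ 2 := by
  set m := ∫ y, h y ∂gaussianReal 0 1 with hm
  have hint : Integrable h (gaussianReal 0 1) := by
    refine Integrable.of_bound hc.aestronglyMeasurable 1 (ae_of_all _ fun x => ?_)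
    rw [Real.norm_eq_abs, abs_of_nonneg (h0 x)]; exact h1 x
  have hm0 : 0 ≤ m := integral_nonneg h0
  have hm1 : m ≤ 1 := by
    calc m ≤ ∫ y, (1:ℝ) ∂gaussianReal 0 1 := integral_mono hint (integrable_const _) h1
      _ = 1 := by simp
  have hk : ∀ x, |h x - m| ≤ 1 := fun x => by
    rw [abs_le]; constructor <;> linarith [h0 x, h1 x]
  set q : ℝ → ℝ := fun t => (h t - m) * Real.exp (-t^2/2) with hq
  have hqc : Continuous q := by fun_prop
  have hqb : ∀ t, ‖q t‖ ≤ Real.exp (-t^2/2) := fun t => by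
    rw [hq]; simp only [norm_mul, Real.norm_eq_abs, Real.abs_exp]
    exact mul_le_of_le_one_left (Real.exp_pos _).le (hk t)
  have hqi : Integrable q :=
    aux_integrable_g.mono' hqc.aestronglyMeasurable (ae_of_all _ hqb)
  have hq0 : ∫ t, q t = 0 := by
    have e1 : ∫ y, (h y - m) ∂gaussianReal 0 1 = 0 := by
      rw [integral_sub hint (integrable_const _)]; simp [hm]
    rw [aux_mean (fun y => h y - m)] at e1
    rcases mul_eq_zero.1 e1 with h | h
    · exact absurd h (by positivity)
    · exact h
  set F : ℝ → ℝ := fun x => ∫ t in Set.Iic x, q t with hF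
  have hFd : ∀ x, HasDerivAt F (q x) x := by
    intro x
    have e : F = fun x => F 0 + ∫ t in (0:ℝ)..x, q t := by
      ext y
      rw [← intervalIntegral.integral_Iic_sub_Iic hqi.integrableOn hqi.integrableOn]
      simp [hF]
    rw [e]
    exact (intervalIntegral.integral_hasDerivAt_right (hqc.intervalIntegrable _ _)
      (hqc.stronglyMeasurableAtFilter _ _) hqc.continuousAt).const_add _
  have hFb : ∀ x, |x * F x| ≤ Real.exp (-x^2/2) := by
    intro x
    rcases le_total 0 x with hx | hx
    · have e : F x = - ∫ t in Set.Ioi x, q t := by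
        have := intervalIntegral.integral_Iic_add_Ioi (b := x) hqi.integrableOn hqi.integrableOn
        rw [hq0] at this
        exact eq_neg_of_add_eq_zero_left this
      rw [e, abs_mul, abs_neg, abs_of_nonneg hx, ← aux_tail_pos x]
      calc x * |∫ t in Set.Ioi x, q t| ≤ x * ∫ t in Set.Ioi x, Real.exp (-t^2/2) := by
            refine mul_le_mul_of_nonneg_left ?_ hx
            exact norm_integral_le_of_norm_le aux_integrable_g.integrableOn (ae_of_all _ hqb)
        _ = ∫ t in Set.Ioi x, x * Real.exp (-t^2/2) := (integral_const_mul _ _).symm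
        _ ≤ _ := by
            refine setIntegral_mono_on (aux_integrable_g.const_mul x).integrableOn
              aux_integrable_tg.integrableOn measurableSet_Ioi fun t ht => ?_
            exact mul_le_mul_of_nonneg_right (le_of_lt ht) (Real.exp_pos _).le
    · rw [abs_mul, abs_of_nonpos hx]
      have := aux_tail_neg x
      calc -x * |∫ t in Set.Iic x, q t| ≤ -x * ∫ t in Set.Iic x, Real.exp (-t^2/2) := by
            refine mul_le_mul_of_nonneg_left ?_ (by linarith)
            exact norm_integral_le_of_norm_le aux_integrable_g.integrableOn (ae_of_all _ hqb)
        _ = -∫ t in Set.Iic x, x * Real.exp (-t^2/2) := by rw [integral_const_mul]; ring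
        _ ≤ -∫ t in Set.Iic x, t * Real.exp (-t^2/2) := by
            refine neg_le_neg (setIntegral_mono_on aux_integrable_tg.integrableOn
              (aux_integrable_g.const_mul x).integrableOn measurableSet_Iic fun t ht => ?_)
            exact mul_le_mul_of_nonneg_right ht (Real.exp_pos _).le
        _ = _ := by rw [this, neg_neg]
  have hee : ∀ x : ℝ, Real.exp (x^2/2) * Real.exp (-x^2/2) = 1 := fun x => by
    rw [← Real.exp_add]; simp [neg_div]
  have hFc : Continuous F := continuous_iff_continuousAt.2 fun x => (hFd x).continuousAt
  refine ⟨fun x => Real.exp (x^2/2) * F x, fun x => x * (Real.exp (x^2/2) * F x) + (h x - m),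
    by fun_prop, fun x => ?_, fun x => by ring, fun x => ?_⟩
  · have hd : HasDerivAt (fun t : ℝ => t^2/2) x x := by
      exact ((hasDerivAt_pow 2 x).div_const 2).congr_deriv (by simp)
    refine (hd.exp.mul (hFd x)).congr_deriv ?_
    simp only [hq]
    linear_combination (h x - m) * hee x
  · have : |x * (Real.exp (x^2/2) * F x)| ≤ 1 := by
      calc _ = Real.exp (x^2/2) * |x * F x| := by
            rw [← Real.abs_exp (x^2/2), ← abs_mul, Real.abs_exp]; ring_nf
        _ ≤ Real.exp (x^2/2) * Real.exp (-x^2/2) :=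
            mul_le_mul_of_nonneg_left (hFb x) (Real.exp_pos _).le
        _ = 1 := hee x
    exact (abs_add_le _ _).trans (by linarith [hk x])

/-- from continuous test functions to measurable sets -/
theorem tv_of_continuous (μ ν : Measure ℝ) [IsProbabilityMeasure μ] [IsProbabilityMeasure ν] (K : ℝ)
    (H : ∀ h : ℝ → ℝ, Continuous h → (∀ x, 0 ≤ h x) → (∀ x, h x ≤ 1) →
      |∫ x, h x ∂μ - ∫ x, h x ∂ν| ≤ K) (s : Set ℝ) (hs : MeasurableSet s) :
    |(μ s).toReal - (ν s).toReal| ≤ K := by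
  refine le_of_forall_pos_le_add fun ε hε => ?_
  have hi : Integrable (s.indicator (fun _ => (1:ℝ))) (μ + ν) :=
    (integrable_const _).indicator hs
  obtain ⟨g, hg, hgi⟩ := hi.exists_boundedContinuous_integral_sub_le hε
  set h : ℝ → ℝ := fun x => max 0 (min (g x) 1) with hh
  have hcont : Continuous h := by fun_prop
  have hb0 : ∀ x, 0 ≤ h x := fun x => le_max_left _ _
  have hb1 : ∀ x, h x ≤ 1 := fun x => max_le zero_le_one (min_le_right _ _)
  have hint : ∀ (ρ : Measure ℝ) [IsFiniteMeasure ρ], Integrable h ρ := fun ρ _ => by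
    refine Integrable.of_bound hcont.aestronglyMeasurable 1 (ae_of_all _ fun x => ?_)
    rw [Real.norm_eq_abs, abs_of_nonneg (hb0 x)]; exact hb1 x
  have hind : ∀ (ρ : Measure ℝ) [IsFiniteMeasure ρ], Integrable (s.indicator (fun _ => (1:ℝ))) ρ :=
    fun ρ _ => (integrable_const _).indicator hs
  have hpt : ∀ x, ‖s.indicator (fun _ => (1:ℝ)) x - h x‖ ≤ ‖s.indicator (fun _ => (1:ℝ)) x - g x‖ := by
    intro x
    have hcl : ∀ a b : ℝ, 0 ≤ a → a ≤ 1 → |a - max 0 (min b 1)| ≤ |a - b| := by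
      intro a b ha0 ha1
      rcases le_total b 1 with h1 | h1
      · rw [min_eq_left h1]
        rcases le_total 0 b with h2 | h2
        · rw [max_eq_right h2]
        · rw [max_eq_left h2, abs_of_nonneg (by linarith), abs_of_nonneg (by linarith)]; linarith
      · rw [min_eq_right h1, max_eq_right zero_le_one, abs_of_nonpos (by linarith),
          abs_of_nonpos (by linarith)]; linarith
    refine hcl _ _ ?_ ?_
    · exact Set.indicator_nonneg (fun _ _ => zero_le_one) x
    · exact Set.indicator_le_self' (fun _ _ => zero_le_one) x
  have hsum : ∫ x, ‖s.indicator (fun _ => (1:ℝ)) x - h x‖ ∂μ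
      + ∫ x, ‖s.indicator (fun _ => (1:ℝ)) x - h x‖ ∂ν ≤ ε := by
    have e := integral_add_measure ((hind μ).sub (hint μ)).norm ((hind ν).sub (hint ν)).norm
    simp only [Pi.sub_apply] at e
    rw [← e]
    exact (integral_mono ((hind _).sub (hint _)).norm ((hind _).sub hgi).norm hpt).trans hg
  have key : ∀ (ρ : Measure ℝ) [IsProbabilityMeasure ρ], |(ρ s).toReal - ∫ x, h x ∂ρ| ≤
      ∫ x, ‖s.indicator (fun _ => (1:ℝ)) x - h x‖ ∂ρ := by
    intro ρ _
    have : (ρ s).toReal = ∫ x, s.indicator (fun _ => (1:ℝ)) x ∂ρ := by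
      rw [integral_indicator_const _ hs]; simp [Measure.real]
    rw [this, ← integral_sub (hind ρ) (hint ρ)]
    exact norm_integral_le_integral_norm (fun x => s.indicator (fun _ => (1:ℝ)) x - h x)
  have a1 := abs_le.1 (key μ)
  have a2 := abs_le.1 (key ν)
  have a3 := abs_le.1 (H h hcont hb0 hb1)
  rw [abs_le]; constructor <;> linarith [a1.1, a1.2, a2.1, a2.2, a3.1, a3.2]

section core
set_option linter.unusedSectionVars false

variable {n : ℕ}

/-- entrywise differentiability of a matrix-valued curve -/
def MD (c : ℝ → Matrix (Fin n) (Fin n) ℝ) (c' : Matrix (Fin n) (Fin n) ℝ) (t : ℝ) : Prop :=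
  ∀ i j, HasDerivAt (fun s => c s i j) (c' i j) t

theorem MD.mul {c d : ℝ → Matrix (Fin n) (Fin n) ℝ} {c' d' : Matrix (Fin n) (Fin n) ℝ} {t : ℝ}
    (hc : MD c c' t) (hd : MD d d' t) : MD (fun s => c s * d s) (c' * d t + c t * d') t := by
  intro i j
  simp only [Matrix.mul_apply, Matrix.add_apply]
  rw [← Finset.sum_add_distrib]
  exact HasDerivAt.fun_sum fun k _ => (hc i k).mul (hd k j)

theorem MD.smul {f : ℝ → ℝ} {f' : ℝ} {d : ℝ → Matrix (Fin n) (Fin n) ℝ}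
    {d' : Matrix (Fin n) (Fin n) ℝ} {t : ℝ}
    (hc : HasDerivAt f f' t) (hd : MD d d' t) : MD (fun s => f s • d s) (f' • d t + f t • d') t := by
  intro i j
  simp only [Matrix.smul_apply, Matrix.add_apply, smul_eq_mul]
  exact hc.mul (hd i j)

theorem MD.add {c d : ℝ → Matrix (Fin n) (Fin n) ℝ} {c' d' : Matrix (Fin n) (Fin n) ℝ} {t : ℝ}
    (hc : MD c c' t) (hd : MD d d' t) : MD (fun s => c s + d s) (c' + d') t :=
  fun i j => (hc i j).add (hd i j)

theorem MD.transpose {c : ℝ → Matrix (Fin n) (Fin n) ℝ} {c' : Matrix (Fin n) (Fin n) ℝ} {t : ℝ}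
    (hc : MD c c' t) : MD (fun s => (c s)ᵀ) c'ᵀ t :=
  fun i j => hc j i

theorem MD.trace {c : ℝ → Matrix (Fin n) (Fin n) ℝ} {c' : Matrix (Fin n) (Fin n) ℝ} {t : ℝ}
    (hc : MD c c' t) : HasDerivAt (fun s => (c s).trace) c'.trace t := by
  simp only [Matrix.trace, Matrix.diag]
  exact HasDerivAt.fun_sum fun k _ => hc k k

theorem MD.const (X : Matrix (Fin n) (Fin n) ℝ) (t : ℝ) : MD (fun _ => X) 0 t :=
  fun _ _ => hasDerivAt_const _ _

theorem MD.congr {c : ℝ → Matrix (Fin n) (Fin n) ℝ} {c' d' : Matrix (Fin n) (Fin n) ℝ} {t : ℝ}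
    (hc : MD c c' t) (h : c' = d') : MD c d' t := h ▸ hc

/-- generator of rotations in the `(i,j)` plane -/
def rotGen (i j : Fin n) : Matrix (Fin n) (Fin n) ℝ := Matrix.single i j 1 - Matrix.single j i 1

theorem rotGen_transpose (i j : Fin n) : (rotGen i j)ᵀ = - rotGen i j := by
  simp [rotGen]

theorem rotGen_cube {i j : Fin n} (hij : i ≠ j) :
    rotGen i j * rotGen i j * rotGen i j = - rotGen i j := by
  simp [rotGen, sub_mul, mul_sub, hij, hij.symm]; abel

/-- rotation matrices -/
noncomputable def rotMat (i j : Fin n) (t : ℝ) : Matrix (Fin n) (Fin n) ℝ :=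
  1 + Real.sin t • rotGen i j + (1 - Real.cos t) • (rotGen i j * rotGen i j)

theorem rotMat_mem {i j : Fin n} (hij : i ≠ j) (t : ℝ) :
    rotMat i j t ∈ Matrix.orthogonalGroup (Fin n) ℝ := by
  rw [Matrix.mem_orthogonalGroup_iff]
  have h3 := rotGen_cube hij
  have e : (rotMat i j t)ᵀ = 1 - Real.sin t • rotGen i j + (1 - Real.cos t) • (rotGen i j * rotGen i j) := by
    simp [rotMat, rotGen_transpose, sub_eq_add_neg]
  rw [e, rotMat]
  set B := rotGen i j
  have h4 : B * B * (B * B) = - (B * B) := by rw [← mul_assoc, h3, neg_mul]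
  have h3' : B * (B * B) = - B := by rw [← mul_assoc, h3]
  have hsc : Real.sin t * Real.sin t + Real.cos t * Real.cos t = 1 := by
    have := Real.sin_sq_add_cos_sq t; nlinarith
  simp only [add_mul, mul_add, mul_sub, one_mul, mul_one, smul_mul_assoc,
    mul_smul_comm, h3, h4, h3', smul_neg]
  have h5 : (1 : Matrix (Fin n) (Fin n) ℝ)
      = 1 + (1 - (Real.sin t * Real.sin t + Real.cos t * Real.cos t)) • (B * B) := by
    rw [hsc]; simp
  refine Eq.trans ?_ h5.symm
  module

theorem rotMat_hasDerivAt {i j : Fin n} (hij : i ≠ j) (t : ℝ) :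
    MD (rotMat i j) (rotGen i j * rotMat i j t) t := by
  have h3 := rotGen_cube hij
  have h3' : rotGen i j * (rotGen i j * rotGen i j) = - rotGen i j := by rw [← mul_assoc, h3]
  have h1 := MD.smul (Real.hasDerivAt_sin t) (MD.const (rotGen i j) t)
  have h2 := MD.smul ((Real.hasDerivAt_cos t).const_sub 1) (MD.const (rotGen i j * rotGen i j) t)
  have := ((MD.const 1 t).add h1).add h2
  refine this.congr ?_
  simp only [rotMat, mul_add, mul_one, mul_smul_comm, h3']
  module

theorem rotMat_zero (i j : Fin n) : rotMat i j 0 = 1 := by simp [rotMat]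

instance orth_compact : CompactSpace (Matrix.orthogonalGroup (Fin n) ℝ) := by
  rw [← isCompact_univ_iff, Subtype.isCompact_iff]
  have hc : IsClosed (Matrix.orthogonalGroup (Fin n) ℝ : Set (Matrix (Fin n) (Fin n) ℝ)) :=
    isClosed_unitary
  have : IsCompact (Set.matrix (Set.Icc (-1:ℝ) 1) : Set (Matrix (Fin n) (Fin n) ℝ)) :=
    isCompact_Icc.matrix
  refine IsCompact.of_isClosed_subset this (by simpa using hc) ?_
  rintro _ ⟨U, -, rfl⟩ i j
  have := entry_norm_bound_of_unitary U.2 i j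
  rw [Real.norm_eq_abs] at this
  exact abs_le.1 this

variable (μ : Measure (Matrix.orthogonalGroup (Fin n) ℝ)) [μ.IsMulLeftInvariant] [IsProbabilityMeasure μ]

theorem orth_integrable (A : Matrix (Fin n) (Fin n) ℝ) (F : Matrix (Fin n) (Fin n) ℝ → ℝ) (hF : Continuous F) :
    Integrable (fun M : Matrix.orthogonalGroup (Fin n) ℝ => F (M.1 * A)) μ := by
  have hc : Continuous (fun M : Matrix.orthogonalGroup (Fin n) ℝ => F (M.1 * A)) := by fun_prop
  exact hc.integrable_of_hasCompactSupport (HasCompactSupport.of_compactSpace _)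

/-- Infinitesimal invariance. -/
theorem mean_deriv_zero (A : Matrix (Fin n) (Fin n) ℝ) (i j : Fin n) (F F' : Matrix (Fin n) (Fin n) ℝ → ℝ)
    (hF : Continuous F) (hF' : Continuous F')
    (hd : ∀ (c : ℝ → Matrix (Fin n) (Fin n) ℝ) (t : ℝ), MD c (rotGen i j * c t) t →
      HasDerivAt (fun s => F (c s)) (F' (c t)) t) :
    ∫ M, F' (M.1 * A) ∂μ = 0 := by
  rcases eq_or_ne i j with rfl | hij
  · have : ∀ X, F' X = 0 := fun X => by
      have h1 := hd (fun _ => X) 0 ((MD.const X 0).congr (by simp [rotGen]))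
      exact h1.unique (hasDerivAt_const _ _)
    simp [this]
  obtain ⟨K, hK⟩ : ∃ K, ∀ M : Matrix.orthogonalGroup (Fin n) ℝ, ‖F' (M.1 * A)‖ ≤ K := by
    have hc : Continuous (fun M : Matrix.orthogonalGroup (Fin n) ℝ => F' (M.1 * A)) := by fun_prop
    obtain ⟨K, hK⟩ := isCompact_univ.exists_bound_of_continuousOn hc.continuousOn
    exact ⟨K, fun M => hK M trivial⟩
  let R : ℝ → Matrix.orthogonalGroup (Fin n) ℝ := fun t => ⟨rotMat i j t, rotMat_mem hij t⟩
  have key := hasDerivAt_integral_of_dominated_loc_of_deriv_le (μ := μ) (s := Set.univ) (x₀ := (0:ℝ))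
    (F := fun t M => F ((R t * M).1 * A)) (F' := fun t M => F' ((R t * M).1 * A))
    (bound := fun _ => K) Filter.univ_mem ?_ ?_ ?_ ?_ (integrable_const _) ?_
  · have h2 := key.2
    have e : (fun t => ∫ M, F ((R t * M).1 * A) ∂μ) = fun _ => ∫ M, F (M.1 * A) ∂μ := by
      ext t
      exact integral_mul_left_eq_self (μ := μ) (fun M => F (M.1 * A)) (R t)
    rw [e] at h2
    have e2 := integral_mul_left_eq_self (μ := μ) (fun M => F' (M.1 * A)) (R 0)
    rw [← e2]
    exact h2.unique (hasDerivAt_const _ _)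
  · refine Filter.Eventually.of_forall fun t => Continuous.aestronglyMeasurable ?_
    fun_prop
  · have hc : Continuous (fun M => F ((R 0 * M).1 * A)) := by fun_prop
    exact hc.integrable_of_hasCompactSupport (HasCompactSupport.of_compactSpace _)
  · refine Continuous.aestronglyMeasurable ?_
    fun_prop
  · exact ae_of_all _ fun M t _ => hK _
  · refine ae_of_all _ fun M t _ => ?_
    refine hd (fun t => (R t * M).1 * A) t ?_
    refine (((rotMat_hasDerivAt hij t).mul (MD.const M.1 t)).mul (MD.const A t)).congr ?_
    simp [R, mul_assoc]

theorem trace_rotGen_mul (i j : Fin n) (X : Matrix (Fin n) (Fin n) ℝ) :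
    (rotGen i j * X).trace = X j i - X i j := by
  simp [rotGen, sub_mul, Matrix.trace_sub, Matrix.trace_single_mul]

theorem rotGen_mul_apply (i j a b : Fin n) (Y : Matrix (Fin n) (Fin n) ℝ) :
    (rotGen i j * Y) a b = (if a = i then Y j b else 0) - (if a = j then Y i b else 0) := by
  simp [rotGen, sub_mul, Matrix.mul_apply, Matrix.single_apply, ite_and, eq_comm]

theorem sum_tr_tr (X Y : Matrix (Fin n) (Fin n) ℝ) :
    ∑ i, ∑ j, (rotGen i j * X).trace * (rotGen i j * Y).trace
      = 2 * ((X * Yᵀ).trace - (X * Y).trace) := by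
  simp only [trace_rotGen_mul]
  have e1 : (X * Yᵀ).trace = ∑ i, ∑ j, X i j * Y i j := by
    simp [Matrix.trace, Matrix.mul_apply]
  have e2 : (X * Y).trace = ∑ i, ∑ j, X i j * Y j i := by
    simp [Matrix.trace, Matrix.mul_apply]
  have e3 : (X * Yᵀ).trace = ∑ i, ∑ j, X j i * Y j i := by
    rw [e1, Finset.sum_comm]
  have e4 : (X * Y).trace = ∑ i, ∑ j, X j i * Y i j := by
    rw [e2, Finset.sum_comm]
  have : 2 * ((X * Yᵀ).trace - (X * Y).trace) =
    (X * Yᵀ).trace + (X * Yᵀ).trace - (X * Y).trace - (X * Y).trace := by ring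
  rw [this]
  nth_rewrite 1 [e1]
  nth_rewrite 1 [e3]
  nth_rewrite 1 [e2]
  nth_rewrite 1 [e4]
  simp only [← Finset.sum_add_distrib, ← Finset.sum_sub_distrib]
  refine Finset.sum_congr rfl fun i _ => Finset.sum_congr rfl fun j _ => by ring

theorem sum_tr_BXBY (X Y : Matrix (Fin n) (Fin n) ℝ) :
    ∑ i, ∑ j, (rotGen i j * (X * (rotGen i j * Y))).trace
      = 2 * ((Xᵀ * Y).trace - X.trace * Y.trace) := by
  have h : ∀ i j : Fin n, (rotGen i j * (X * (rotGen i j * Y))).trace =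
      X j i * Y j i - X j j * Y i i - X i i * Y j j + X i j * Y i j := by
    intro i j
    rw [trace_rotGen_mul]
    rw [Matrix.mul_apply, Matrix.mul_apply]
    simp only [rotGen_mul_apply]
    simp [mul_sub, Finset.sum_sub_distrib]
    ring
  simp only [h]
  have e1 : (Xᵀ * Y).trace = ∑ i, ∑ j, X j i * Y j i := by
    simp [Matrix.trace, Matrix.mul_apply]
  have e3 : (Xᵀ * Y).trace = ∑ i, ∑ j, X i j * Y i j := by
    rw [e1, Finset.sum_comm]
  have e2 : X.trace * Y.trace = ∑ i, ∑ j, X i i * Y j j := by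
    simp [Matrix.trace, Finset.sum_mul_sum]
  have e4 : X.trace * Y.trace = ∑ i, ∑ j, X j j * Y i i := by
    rw [e2, Finset.sum_comm]
  simp only [Finset.sum_add_distrib, Finset.sum_sub_distrib]
  rw [← e1, ← e2, ← e3, ← e4]; ring

variable (A : Matrix (Fin n) (Fin n) ℝ)

/-- expectation of a function of `C = M A` -/
noncomputable def EE (F : Matrix (Fin n) (Fin n) ℝ → ℝ) : ℝ := ∫ M, F (M.1 * A) ∂μ

theorem EE_add (F G : Matrix (Fin n) (Fin n) ℝ → ℝ) (hF : Continuous F) (hG : Continuous G) :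
    EE μ A (fun C => F C + G C) = EE μ A F + EE μ A G :=
  integral_add (orth_integrable μ A F hF) (orth_integrable μ A G hG)

theorem EE_sub (F G : Matrix (Fin n) (Fin n) ℝ → ℝ) (hF : Continuous F) (hG : Continuous G) :
    EE μ A (fun C => F C - G C) = EE μ A F - EE μ A G :=
  integral_sub (orth_integrable μ A F hF) (orth_integrable μ A G hG)

theorem EE_mul (r : ℝ) (F : Matrix (Fin n) (Fin n) ℝ → ℝ) :
    EE μ A (fun C => r * F C) = r * EE μ A F :=
  integral_const_mul _ _

theorem EE_const (r : ℝ) : EE μ A (fun _ => r) = r := by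
  simp [EE]

theorem EE_mono (F G : Matrix (Fin n) (Fin n) ℝ → ℝ) (hF : Continuous F) (hG : Continuous G)
    (h : ∀ C, F C ≤ G C) : EE μ A F ≤ EE μ A G :=
  integral_mono (orth_integrable μ A F hF) (orth_integrable μ A G hG) fun _ => h _

theorem EE_sum {ι : Type*} (s : Finset ι) (F : ι → Matrix (Fin n) (Fin n) ℝ → ℝ)
    (hF : ∀ i, Continuous (F i)) :
    EE μ A (fun C => ∑ i ∈ s, F i C) = ∑ i ∈ s, EE μ A (F i) :=
  integral_finsetSum _ fun i _ => orth_integrable μ A (F i) (hF i)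

theorem EE_congr (F G : Matrix (Fin n) (Fin n) ℝ → ℝ) (h : ∀ C, Cᵀ * C = Aᵀ * A → F C = G C) :
    EE μ A F = EE μ A G := by
  refine integral_congr_ae (ae_of_all _ fun M => h _ ?_)
  have := (Matrix.mem_orthogonalGroup_iff' (Fin n) ℝ).1 M.2
  rw [Matrix.transpose_mul, Matrix.mul_assoc, ← Matrix.mul_assoc _ M.1, this, Matrix.one_mul]

theorem ibp (F : Matrix (Fin n) (Fin n) ℝ → Matrix (Fin n) (Fin n) ℝ)
    (F' : Matrix (Fin n) (Fin n) ℝ → Matrix (Fin n) (Fin n) ℝ → Matrix (Fin n) (Fin n) ℝ)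
    (hF : Continuous F) (hF' : ∀ B, Continuous (F' B))
    (hd : ∀ B (c : ℝ → Matrix (Fin n) (Fin n) ℝ) (t : ℝ), MD c (B * c t) t →
      MD (fun s => F (c s)) (F' B (c t)) t)
    (D : Matrix (Fin n) (Fin n) ℝ → ℝ)
    (hD : ∀ C, Cᵀ * C = Aᵀ * A →
      ∑ i, ∑ j, (rotGen i j * (C * F' (rotGen i j) C)).trace = 2 * D C) :
    EE μ A D = ((n : ℝ) - 1) * EE μ A (fun C => (C * F C).trace) := by
  have h0 : ∀ i j : Fin n, EE μ A (fun C =>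
      (rotGen i j * (1 * (rotGen i j * (C * F C)))).trace
        + (rotGen i j * (C * F' (rotGen i j) C)).trace) = 0 := by
    intro i j
    have hF2 := hF' (rotGen i j)
    refine mean_deriv_zero μ A i j (fun C => (rotGen i j * (C * F C)).trace)
      (fun C => (rotGen i j * (1 * (rotGen i j * (C * F C)))).trace
        + (rotGen i j * (C * F' (rotGen i j) C)).trace)
      (by fun_prop) (by fun_prop) ?_
    intro c t hc
    have := ((MD.const (rotGen i j) t).mul (hc.mul (hd _ c t hc))).trace
    refine this.congr_deriv ?_
    simp [mul_add, mul_assoc, Matrix.trace_add]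
  have h1 : EE μ A (fun C => ∑ i, ∑ j, ((rotGen i j * (1 * (rotGen i j * (C * F C)))).trace
        + (rotGen i j * (C * F' (rotGen i j) C)).trace)) = 0 := by
    have hc : ∀ i j : Fin n, Continuous (fun C => (rotGen i j * (1 * (rotGen i j * (C * F C)))).trace
        + (rotGen i j * (C * F' (rotGen i j) C)).trace) := by
      intro i j
      have hF2 := hF' (rotGen i j)
      fun_prop
    rw [EE_sum _ _ _ _ (fun i => continuous_finsetSum _ fun j _ => hc i j)]
    refine Finset.sum_eq_zero fun i _ => ?_
    rw [EE_sum _ _ _ _ (fun j => hc i j)]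
    exact Finset.sum_eq_zero fun j _ => h0 i j
  have h2 : EE μ A D = EE μ A (fun C => (1/2 : ℝ) * (∑ i, ∑ j, ((rotGen i j * (1 * (rotGen i j * (C * F C)))).trace
        + (rotGen i j * (C * F' (rotGen i j) C)).trace)) + ((n:ℝ)-1) * (C * F C).trace) := by
    refine EE_congr μ A _ _ fun C hC => ?_
    simp only [Finset.sum_add_distrib]
    rw [hD C hC, sum_tr_BXBY]
    simp [Matrix.trace_one]
    ring
  rw [h2, EE_add, EE_mul, EE_mul, h1]
  · ring
  · have : ∀ i j : Fin n, Continuous (F' (rotGen i j)) := fun i j => hF' _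
    fun_prop
  · fun_prop

theorem id_b (S : Matrix (Fin n) (Fin n) ℝ) (hS : Sᵀ = S) :
    ((n : ℝ) - 1) * EE μ A (fun C => C.trace * (C * S).trace)
      = (S * (Aᵀ * A)).trace - EE μ A (fun C => (C * C * S).trace) := by
  have h := ibp μ A (fun C => (C * S).trace • (1 : Matrix (Fin n) (Fin n) ℝ))
    (fun B C => (B * C * S).trace • (1 : Matrix (Fin n) (Fin n) ℝ)) (by fun_prop)
    (fun B => by fun_prop)
    (fun B c t hc => (MD.smul (hc.mul (MD.const S t)).trace (MD.const 1 t)).congr (by simp))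
    (fun C => (S * (Aᵀ * A)).trace - (C * C * S).trace) (by
      intro C hC
      have := sum_tr_tr C (C * S)
      rw [Matrix.transpose_mul, hS, ← mul_assoc, Matrix.trace_mul_cycle, ← mul_assoc, Matrix.trace_mul_comm,
        hC] at this
      rw [← this]
      refine Finset.sum_congr rfl fun i _ => Finset.sum_congr rfl fun j _ => ?_
      simp [mul_assoc, mul_comm])
  rw [EE_sub _ _ _ _ (by fun_prop) (by fun_prop), EE_const] at h
  rw [h]
  congr 2
  ext C
  simp [mul_comm]

theorem id_c (S : Matrix (Fin n) (Fin n) ℝ) :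
    ((n : ℝ) - 1) * EE μ A (fun C => (C * C * S).trace)
      = (S * (Aᵀ * A)).trace - EE μ A (fun C => C.trace * (C * S).trace) := by
  have h := ibp μ A (fun C => C * S)
    (fun B C => B * C * S) (by fun_prop)
    (fun B => by fun_prop)
    (fun B c t hc => (hc.mul (MD.const S t)).congr (by simp))
    (fun C => (S * (Aᵀ * A)).trace - C.trace * (C * S).trace) (by
      intro C hC
      have := sum_tr_BXBY C (C * S)
      rw [← mul_assoc, hC, Matrix.trace_mul_comm] at this
      rw [← this]
      refine Finset.sum_congr rfl fun i _ => Finset.sum_congr rfl fun j _ => ?_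
      simp [mul_assoc])
  rw [EE_sub _ _ _ _ (by fun_prop) (by fun_prop), EE_const] at h
  rw [h]
  simp [mul_assoc]

theorem id_bc (hn : 3 ≤ n) (S : Matrix (Fin n) (Fin n) ℝ) (hS : Sᵀ = S) :
    (n : ℝ) * EE μ A (fun C => C.trace * (C * S).trace) = (S * (Aᵀ * A)).trace ∧
    (n : ℝ) * EE μ A (fun C => (C * C * S).trace) = (S * (Aᵀ * A)).trace := by
  have h1 := id_b μ A S hS
  have h2 := id_c μ A S
  have hn' : (3:ℝ) ≤ n := by exact_mod_cast hn
  have h3 : EE μ A (fun C => C.trace * (C * S).trace) = EE μ A (fun C => (C * C * S).trace) := by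
    have : ((n:ℝ) - 2) * (EE μ A (fun C => C.trace * (C * S).trace) - EE μ A (fun C => (C * C * S).trace)) = 0 := by
      linear_combination h1 - h2
    rcases mul_eq_zero.1 this with h | h <;> linarith
  constructor
  · rw [← h3] at h1; linear_combination h1
  · rw [h3] at h2; linear_combination h2

theorem id_d : (n : ℝ) * EE μ A (fun C => (C * Cᵀ * (Aᵀ * A)).trace) = (Aᵀ * A).trace ^ 2 := by
  have h := ibp μ A (fun C => Cᵀ * (Aᵀ * A))
    (fun B C => (B * C)ᵀ * (Aᵀ * A)) (by fun_prop)
    (fun B => by fun_prop)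
    (fun B c t hc => (hc.transpose.mul (MD.const (Aᵀ * A) t)).congr (by simp))
    (fun C => (Aᵀ * A).trace ^ 2 - (C * Cᵀ * (Aᵀ * A)).trace) (by
      intro C hC
      have := sum_tr_BXBY (C * Cᵀ) (Aᵀ * A)
      rw [Matrix.transpose_mul, Matrix.transpose_transpose, Matrix.trace_mul_comm C Cᵀ, hC] at this
      have e : 2 * ((Aᵀ * A).trace ^ 2 - (C * Cᵀ * (Aᵀ * A)).trace) =
        - (2 * ((C * Cᵀ * (Aᵀ * A)).trace - (Aᵀ * A).trace * (Aᵀ * A).trace)) := by ring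
      rw [e, ← this, ← Finset.sum_neg_distrib]
      refine Finset.sum_congr rfl fun i _ => ?_
      rw [← Finset.sum_neg_distrib]
      refine Finset.sum_congr rfl fun j _ => ?_
      simp [mul_assoc, rotGen_transpose])
  rw [EE_sub _ _ _ _ (by fun_prop) (by fun_prop), EE_const] at h
  simp only [← mul_assoc] at h ⊢
  linear_combination -h

theorem id_1 : ((n : ℝ) - 1) * EE μ A (fun C => (C * C).trace * (C * C).trace)
    = 2 * (EE μ A (fun C => (C * Cᵀ * (Aᵀ * A)).trace) - EE μ A (fun C => (C * C * C * C).trace))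
      + (Aᵀ * A).trace * EE μ A (fun C => (C * C).trace)
      - EE μ A (fun C => C.trace * C.trace * (C * C).trace) := by
  have h := ibp μ A (fun C => (C * C).trace • C)
    (fun B C => (B * C * C + C * (B * C)).trace • C + (C * C).trace • (B * C)) (by fun_prop)
    (fun B => by fun_prop)
    (fun B c t hc => MD.smul (hc.mul hc).trace hc)
    (fun C => 2 * ((C * Cᵀ * (Aᵀ * A)).trace - (C * C * C * C).trace)
      + (Aᵀ * A).trace * (C * C).trace - C.trace * C.trace * (C * C).trace) (by
      intro C hC
      have h1 := sum_tr_tr (C * C) (C * C)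
      have h2 := sum_tr_BXBY C C
      have e1 : (C * C * (C * C)ᵀ).trace = (C * Cᵀ * (Aᵀ * A)).trace := by
        rw [← hC, Matrix.transpose_mul, Matrix.mul_assoc, Matrix.trace_mul_comm]
        simp only [mul_assoc]
      rw [hC] at h2
      rw [e1] at h1
      have e : 2 * (2 * ((C * Cᵀ * (Aᵀ * A)).trace - (C * C * C * C).trace)
        + (Aᵀ * A).trace * (C * C).trace - C.trace * C.trace * (C * C).trace)
        = 2 * (2 * ((C * Cᵀ * (Aᵀ * A)).trace - (C * C * (C * C)).trace))
          + (C * C).trace * (2 * ((Aᵀ * A).trace - C.trace * C.trace)) := by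
        rw [← mul_assoc (C * C)]; ring
      rw [e, ← h1, ← h2, Finset.mul_sum, Finset.mul_sum, ← Finset.sum_add_distrib]
      refine Finset.sum_congr rfl fun i _ => ?_
      rw [Finset.mul_sum, Finset.mul_sum, ← Finset.sum_add_distrib]
      refine Finset.sum_congr rfl fun j _ => ?_
      have e2 : (C * (rotGen i j * C)).trace = (rotGen i j * (C * C)).trace := by
        rw [Matrix.trace_mul_comm, mul_assoc]
      simp only [mul_add, Matrix.trace_add, Matrix.mul_smul, Matrix.trace_smul, smul_eq_mul, e2, mul_assoc]
      ring)
  rw [EE_sub _ _ _ _ (by fun_prop) (by fun_prop), EE_add _ _ _ _ (by fun_prop) (by fun_prop),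
    EE_mul, EE_mul, EE_sub _ _ _ _ (by fun_prop) (by fun_prop)] at h
  rw [h]
  simp

theorem id_2 : ((n : ℝ) - 1) * EE μ A (fun C => (C * C * C * C).trace)
    = 2 * EE μ A (fun C => (C * C * (Aᵀ * A)).trace) - 2 * EE μ A (fun C => C.trace * (C * C * C).trace)
      + EE μ A (fun C => (C * Cᵀ * (Aᵀ * A)).trace)
      - EE μ A (fun C => (C * C).trace * (C * C).trace) := by
  have h := ibp μ A (fun C => C * C * C)
    (fun B C => (B * C * C + C * (B * C)) * C + C * C * (B * C)) (by fun_prop)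
    (fun B => by fun_prop)
    (fun B c t hc => (hc.mul hc).mul hc)
    (fun C => 2 * (C * C * (Aᵀ * A)).trace - 2 * (C.trace * (C * C * C).trace)
      + (C * Cᵀ * (Aᵀ * A)).trace - (C * C).trace * (C * C).trace) (by
      intro C hC
      have h1 := sum_tr_BXBY C (C * C * C)
      have h2 := sum_tr_BXBY (C * C) (C * C)
      have h3 := sum_tr_BXBY (C * C * C) C
      have e1 : (Cᵀ * (C * C * C)).trace = (C * C * (Aᵀ * A)).trace := by
        rw [← hC, Matrix.trace_mul_comm (C * C)]
        simp only [mul_assoc]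
      have e2 : ((C * C)ᵀ * (C * C)).trace = (C * Cᵀ * (Aᵀ * A)).trace := by
        rw [← hC, Matrix.transpose_mul, Matrix.mul_assoc, Matrix.mul_assoc, Matrix.trace_mul_comm C]
        simp only [mul_assoc]
      have e3 : ((C * C * C)ᵀ * C).trace = (C * C * (Aᵀ * A)).trace := by
        rw [← e1, ← Matrix.trace_transpose, Matrix.transpose_mul, Matrix.transpose_transpose]
      rw [e1] at h1
      rw [e2] at h2
      rw [e3] at h3
      have e : 2 * (2 * (C * C * (Aᵀ * A)).trace - 2 * (C.trace * (C * C * C).trace)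
          + (C * Cᵀ * (Aᵀ * A)).trace - (C * C).trace * (C * C).trace)
        = 2 * ((C * C * (Aᵀ * A)).trace - C.trace * (C * C * C).trace)
          + 2 * ((C * Cᵀ * (Aᵀ * A)).trace - (C * C).trace * (C * C).trace)
          + 2 * ((C * C * (Aᵀ * A)).trace - (C * C * C).trace * C.trace) := by ring
      rw [e, ← h1, ← h2, ← h3, ← Finset.sum_add_distrib, ← Finset.sum_add_distrib]
      refine Finset.sum_congr rfl fun i _ => ?_
      rw [← Finset.sum_add_distrib, ← Finset.sum_add_distrib]
      refine Finset.sum_congr rfl fun j _ => ?_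
      simp only [mul_add, add_mul, Matrix.trace_add, mul_assoc])
  rw [EE_sub _ _ _ _ (by fun_prop) (by fun_prop), EE_add _ _ _ _ (by fun_prop) (by fun_prop),
    EE_sub _ _ _ _ (by fun_prop) (by fun_prop), EE_mul, EE_mul] at h
  rw [h]
  simp only [mul_assoc]

theorem id_4 : ((n : ℝ) - 1) * EE μ A (fun C => C.trace * (C * C * C).trace)
    = 3 * (EE μ A (fun C => (C * C * (Aᵀ * A)).trace) - EE μ A (fun C => (C * C * C * C).trace)) := by
  have h := ibp μ A (fun C => (C * C * C).trace • (1 : Matrix (Fin n) (Fin n) ℝ))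
    (fun B C => ((B * C * C + C * (B * C)) * C + C * C * (B * C)).trace • (1 : Matrix (Fin n) (Fin n) ℝ))
    (by fun_prop)
    (fun B => by fun_prop)
    (fun B c t hc => (MD.smul ((hc.mul hc).mul hc).trace (MD.const 1 t)).congr (by simp))
    (fun C => 3 * ((C * C * (Aᵀ * A)).trace - (C * C * C * C).trace)) (by
      intro C hC
      have h1 := sum_tr_tr C (C * C * C)
      have e1 : (C * (C * C * C)ᵀ).trace = (C * C * (Aᵀ * A)).trace := by
        rw [← hC, Matrix.trace_mul_comm (C * C), ← Matrix.trace_transpose, Matrix.transpose_mul,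
          Matrix.transpose_transpose, Matrix.trace_mul_comm]
        simp only [mul_assoc]
      rw [e1] at h1
      have e : 2 * (3 * ((C * C * (Aᵀ * A)).trace - (C * C * C * C).trace))
        = 3 * (2 * ((C * C * (Aᵀ * A)).trace - (C * (C * C * C)).trace)) := by
        simp only [mul_assoc C]; ring
      rw [e, ← h1, Finset.mul_sum]
      refine Finset.sum_congr rfl fun i _ => ?_
      rw [Finset.mul_sum]
      refine Finset.sum_congr rfl fun j _ => ?_
      have e2 : (C * (rotGen i j * (C * C))).trace = (rotGen i j * (C * (C * C))).trace := by
        rw [Matrix.trace_mul_comm, mul_assoc, mul_assoc]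
      have e3 : (C * (C * (rotGen i j * C))).trace = (rotGen i j * (C * (C * C))).trace := by
        rw [← mul_assoc, Matrix.trace_mul_comm, mul_assoc]
      simp only [mul_add, add_mul, Matrix.trace_add, Matrix.mul_smul, Matrix.trace_smul, smul_eq_mul,
        mul_assoc, mul_one, e2, e3]
      ring)
  rw [EE_mul, EE_sub _ _ _ _ (by fun_prop) (by fun_prop)] at h
  rw [h]
  simp [mul_comm]

theorem id_5 : ((n : ℝ) - 1) * EE μ A (fun C => C.trace * C.trace * (C * C).trace)
    = (Aᵀ * A).trace * EE μ A (fun C => (C * C).trace) - EE μ A (fun C => (C * C).trace * (C * C).trace)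
      + 2 * (EE μ A (fun C => C.trace * (C * (Aᵀ * A)).trace) - EE μ A (fun C => C.trace * (C * C * C).trace)) := by
  have h := ibp μ A (fun C => (C.trace * (C * C).trace) • (1 : Matrix (Fin n) (Fin n) ℝ))
    (fun B C => ((B * C).trace * (C * C).trace + C.trace * (B * C * C + C * (B * C)).trace)
      • (1 : Matrix (Fin n) (Fin n) ℝ))
    (by fun_prop)
    (fun B => by fun_prop)
    (fun B c t hc => (MD.smul (hc.trace.mul (hc.mul hc).trace) (MD.const 1 t)).congr (by simp))
    (fun C => (Aᵀ * A).trace * (C * C).trace - (C * C).trace * (C * C).trace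
      + 2 * (C.trace * (C * (Aᵀ * A)).trace - C.trace * (C * C * C).trace)) (by
      intro C hC
      have h1 := sum_tr_tr C C
      have h2 := sum_tr_tr C (C * C)
      have e1 : (C * (C * C)ᵀ).trace = (C * (Aᵀ * A)).trace := by
        rw [← hC, Matrix.trace_mul_comm C (Cᵀ * C), ← Matrix.trace_transpose, Matrix.transpose_mul,
          Matrix.transpose_transpose, Matrix.trace_mul_comm]
        simp only [mul_assoc]
      rw [e1] at h2
      rw [Matrix.trace_mul_comm C Cᵀ, hC] at h1
      have e : 2 * ((Aᵀ * A).trace * (C * C).trace - (C * C).trace * (C * C).trace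
      + 2 * (C.trace * (C * (Aᵀ * A)).trace - C.trace * (C * C * C).trace))
        = (C * C).trace * (2 * ((Aᵀ * A).trace - (C * C).trace))
          + (2 * C.trace) * (2 * ((C * (Aᵀ * A)).trace - (C * (C * C)).trace)) := by
        simp only [mul_assoc C]; ring
      rw [e, ← h1, ← h2, Finset.mul_sum, Finset.mul_sum, ← Finset.sum_add_distrib]
      refine Finset.sum_congr rfl fun i _ => ?_
      rw [Finset.mul_sum, Finset.mul_sum, ← Finset.sum_add_distrib]
      refine Finset.sum_congr rfl fun j _ => ?_
      have e2 : (C * (rotGen i j * C)).trace = (rotGen i j * (C * C)).trace := by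
        rw [Matrix.trace_mul_comm, mul_assoc]
      simp only [Matrix.trace_add, Matrix.mul_smul, Matrix.trace_smul, smul_eq_mul,
        Matrix.mul_assoc, Matrix.mul_one, e2]
      ring)
  rw [EE_add _ _ _ _ (by fun_prop) (by fun_prop), EE_sub _ _ _ _ (by fun_prop) (by fun_prop),
    EE_mul, EE_mul, EE_sub _ _ _ _ (by fun_prop) (by fun_prop)] at h
  rw [h]
  congr 2
  ext C
  simp
  ring

theorem id_a (f f' : ℝ → ℝ) (hf' : Continuous f') (hd : ∀ x, HasDerivAt f (f' x) x) :
    ((n : ℝ) - 1) * EE μ A (fun C => C.trace * f C.trace)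
    = EE μ A (fun C => f' C.trace * ((Aᵀ * A).trace - (C * C).trace)) := by
  have hf : Continuous f := continuous_iff_continuousAt.2 fun x => (hd x).continuousAt
  have h := ibp μ A (fun C => (f C.trace) • (1 : Matrix (Fin n) (Fin n) ℝ))
    (fun B C => (f' C.trace * (B * C).trace) • (1 : Matrix (Fin n) (Fin n) ℝ))
    (by fun_prop)
    (fun B => by fun_prop)
    (fun B c t hc => (MD.smul ((hd _).comp t hc.trace) (MD.const 1 t)).congr (by simp))
    (fun C => f' C.trace * ((Aᵀ * A).trace - (C * C).trace)) (by
      intro C hC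
      have h1 := sum_tr_tr C C
      rw [Matrix.trace_mul_comm C Cᵀ, hC] at h1
      have e : 2 * (f' C.trace * ((Aᵀ * A).trace - (C * C).trace))
        = f' C.trace * (2 * ((Aᵀ * A).trace - (C * C).trace)) := by ring
      rw [e, ← h1, Finset.mul_sum]
      refine Finset.sum_congr rfl fun i _ => ?_
      rw [Finset.mul_sum]
      refine Finset.sum_congr rfl fun j _ => ?_
      simp only [Matrix.mul_smul, Matrix.trace_smul, smul_eq_mul, Matrix.mul_one]
      ring)
  rw [h]
  congr 2
  ext C
  simp [mul_comm]

/-- Fourth-moment bound. -/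
theorem second_moment_p2 (hn : 5 ≤ n) (hA : (Aᵀ * A).trace = n) :
    EE μ A (fun C => (C * C).trace) = 1 ∧
    EE μ A (fun C => (C * C).trace * (C * C).trace) ≤ 3 := by
  have hn' : (5:ℝ) ≤ n := by exact_mod_cast hn
  have hP : (Aᵀ * A)ᵀ = Aᵀ * A := by simp
  have b1 := (id_bc μ A (by omega) 1 (by simp)).2
  obtain ⟨c1, c2⟩ := id_bc μ A (by omega) (Aᵀ * A) hP
  have d := id_d μ A
  have i1 := id_1 μ A
  have i2 := id_2 μ A
  have i4 := id_4 μ A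
  have i5 := id_5 μ A
  have hT : (n:ℝ) ≤ (Aᵀ * A * (Aᵀ * A)).trace := by
    have h0 : 0 ≤ ((Aᵀ * A - 1)ᵀ * (Aᵀ * A - 1)).trace := by
      simp only [Matrix.trace, Matrix.diag, Matrix.mul_apply, Matrix.transpose_apply]
      exact Finset.sum_nonneg fun i _ => Finset.sum_nonneg fun j _ => mul_self_nonneg _
    rw [Matrix.transpose_sub, hP, Matrix.transpose_one] at h0
    simp only [sub_mul, mul_sub, mul_one, one_mul, Matrix.trace_sub, hA, Matrix.trace_one,
      Fintype.card_fin] at h0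
    linarith
  simp only [one_mul, mul_one, hA] at b1 d i1 i2 i4 i5
  generalize (Aᵀ * A * (Aᵀ * A)).trace = T at *
  have hb : EE μ A (fun C => (C * C).trace) = 1 := by
    have : (n:ℝ) ≠ 0 := by linarith
    exact mul_left_cancel₀ this (by linarith)
  have hd' : EE μ A (fun C => (C * Cᵀ * (Aᵀ * A)).trace) = n := by
    have : (n:ℝ) ≠ 0 := by linarith
    exact mul_left_cancel₀ this (by linarith)
  refine ⟨hb, ?_⟩
  rw [hb, hd'] at i1
  rw [hd'] at i2
  rw [hb] at i5
  generalize EE μ A (fun C => (C * C).trace * (C * C).trace) = x at *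
  generalize EE μ A (fun C => (C * C * C * C).trace) = w at *
  generalize EE μ A (fun C => C.trace * C.trace * (C * C).trace) = z at *
  generalize EE μ A (fun C => C.trace * (C * C * C).trace) = u at *
  generalize EE μ A (fun C => C.trace * (C * (Aᵀ * A)).trace) = a at *
  generalize EE μ A (fun C => (C * C * (Aᵀ * A)).trace) = b at *
  generalize (n:ℝ) = m at *
  have hab : a = b := mul_left_cancel₀ (show m ≠ 0 by linarith) (by linarith)
  subst hab
  have ha : 1 ≤ a := by nlinarith
  have hzw : z = w := mul_left_cancel₀ (show m - 1 ≠ 0 by linarith) (by linarith)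
  subst hzw
  have hz : (m + 2) * z = 2 * a + m :=
    mul_left_cancel₀ (show (m - 1) * (m - 4) ≠ 0 from mul_ne_zero (by linarith) (by linarith)) (by
      linear_combination (m - 1) * ((m - 1) * i2 - 2 * i4 - i1))
  have hz1 : 1 ≤ z := by nlinarith
  nlinarith

theorem stein_bound (hn : 5 ≤ n) (hA : (Aᵀ * A).trace = n) (h : ℝ → ℝ) (hc : Continuous h)
    (h0 : ∀ x, 0 ≤ h x) (h1 : ∀ x, h x ≤ 1) :
    |EE μ A (fun C => h C.trace) - ∫ x, h x ∂gaussianReal 0 1| ≤ 2 * Real.sqrt 3 / ((n : ℝ) - 1) := by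
  have hn' : (5:ℝ) ≤ n := by exact_mod_cast hn
  obtain ⟨f, f', hf'c, hd, hst, hb⟩ := stein_solution h hc h0 h1
  have hf : Continuous f := continuous_iff_continuousAt.2 fun x => (hd x).continuousAt
  obtain ⟨m1, m2⟩ := second_moment_p2 μ A hn hA
  have ha := id_a μ A f f' hf'c hd
  rw [hA] at ha
  have e1 : EE μ A (fun C => h C.trace) - ∫ x, h x ∂gaussianReal 0 1
      = EE μ A (fun C => f' C.trace) - EE μ A (fun C => C.trace * f C.trace) := by
    rw [← EE_sub _ _ _ _ (by fun_prop) (by fun_prop)]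
    simp only [hst]
    rw [EE_sub _ _ _ _ (by fun_prop) (by fun_prop), EE_const]
  have e2 : EE μ A (fun C => f' C.trace * ((n:ℝ) - (C * C).trace))
      = ((n:ℝ) - 1) * EE μ A (fun C => f' C.trace)
        - EE μ A (fun C => f' C.trace * ((C * C).trace - 1)) := by
    rw [← EE_mul, ← EE_sub _ _ _ _ (by fun_prop) (by fun_prop)]
    congr 1; ext C; ring
  have e3 : ((n:ℝ) - 1) * (EE μ A (fun C => h C.trace) - ∫ x, h x ∂gaussianReal 0 1)
      = EE μ A (fun C => f' C.trace * ((C * C).trace - 1)) := by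
    rw [e1]; linear_combination -e2 - ha
  have hs3 : Real.sqrt 3 * Real.sqrt 3 = 3 := Real.mul_self_sqrt (by norm_num)
  have hs0 : 0 < Real.sqrt 3 := by positivity
  -- AM-GM bound
  have hG : EE μ A (fun C => (Real.sqrt 3)⁻¹ * ((C * C).trace * (C * C).trace - 2 * (C * C).trace + 4))
      ≤ 2 * Real.sqrt 3 := by
    rw [EE_mul, EE_add _ _ _ _ (by fun_prop) (by fun_prop), EE_sub _ _ _ _ (by fun_prop) (by fun_prop),
      EE_mul, EE_const, m1, inv_mul_le_iff₀ hs0]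
    nlinarith
  have hpt : ∀ C : Matrix (Fin n) (Fin n) ℝ, |f' C.trace * ((C * C).trace - 1)| ≤
      (Real.sqrt 3)⁻¹ * ((C * C).trace * (C * C).trace - 2 * (C * C).trace + 4) := by
    intro C
    rw [abs_mul]
    have h2 : |f' C.trace| * |(C * C).trace - 1| ≤ 2 * |(C * C).trace - 1| :=
      mul_le_mul_of_nonneg_right (hb _) (abs_nonneg _)
    refine h2.trans ?_
    rw [inv_mul_eq_div, le_div_iff₀ hs0]
    have := sq_nonneg (|(C * C).trace - 1| - Real.sqrt 3)
    have h3 := abs_mul_abs_self ((C * C).trace - 1)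
    nlinarith
  have hub : |EE μ A (fun C => f' C.trace * ((C * C).trace - 1))| ≤ 2 * Real.sqrt 3 := by
    rw [abs_le]
    constructor
    · have := EE_mono μ A (fun C => (-1) * ((Real.sqrt 3)⁻¹ * ((C * C).trace * (C * C).trace - 2 * (C * C).trace + 4)))
        (fun C => f' C.trace * ((C * C).trace - 1)) (by fun_prop) (by fun_prop)
        (fun C => by linarith [(abs_le.1 (hpt C)).1])
      rw [EE_mul] at this
      linarith
    · have := EE_mono μ A (fun C => f' C.trace * ((C * C).trace - 1))
        (fun C => (Real.sqrt 3)⁻¹ * ((C * C).trace * (C * C).trace - 2 * (C * C).trace + 4))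
        (by fun_prop) (by fun_prop)
        (fun C => (abs_le.1 (hpt C)).2)
      linarith
  rw [← e3, abs_mul, abs_of_pos (by linarith)] at hub
  rw [le_div_iff₀ (by linarith)]
  linarith

end core

/-- Total variation bound for linear functions on the orthogonal group:
if `tr (A Aᵀ) = n` and `M` is Haar-distributed on `O(n)`, then the law of
`W = tr (A M)` is within total variation distance `2√3/(n-1)` of a standard
Gaussian. -/
theorem tv_bound_trace_orthogonal (n : ℕ) (hn : 2 ≤ n)
    (A : Matrix (Fin n) (Fin n) ℝ) (hA : (A * Aᵀ).trace = (n : ℝ))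
    (μ : Measure (Matrix.orthogonalGroup (Fin n) ℝ))
    [μ.IsHaarMeasure] [IsProbabilityMeasure μ] :
    ∀ s : Set ℝ, MeasurableSet s →
      |((μ.map (fun M : Matrix.orthogonalGroup (Fin n) ℝ => (A * (M : Matrix (Fin n) (Fin n) ℝ)).trace)) s).toReal
          - ((gaussianReal 0 1) s).toReal|
        ≤ 2 * Real.sqrt 3 / ((n : ℝ) - 1) := by
  have hcont : Continuous (fun M : Matrix.orthogonalGroup (Fin n) ℝ =>
      (A * (M : Matrix (Fin n) (Fin n) ℝ)).trace) := by fun_prop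
  have : IsProbabilityMeasure (μ.map (fun M : Matrix.orthogonalGroup (Fin n) ℝ =>
      (A * (M : Matrix (Fin n) (Fin n) ℝ)).trace)) :=
    Measure.isProbabilityMeasure_map hcont.measurable.aemeasurable
  refine tv_of_continuous _ _ _ fun h hc h0 h1 => ?_
  rw [integral_map hcont.measurable.aemeasurable hc.aestronglyMeasurable]
  rcases Nat.lt_or_ge n 5 with h5 | h5
  · have hn1 : (2:ℝ) ≤ n := by exact_mod_cast hn
    have hn2 : (n:ℝ) ≤ 4 := by exact_mod_cast (by omega : n ≤ 4)
    have hs : (3/2 : ℝ) ≤ Real.sqrt 3 := Real.le_sqrt_of_sq_le (by norm_num)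
    have hbd : ∀ {Ω : Type} [MeasurableSpace Ω] (ρ : Measure Ω) [IsProbabilityMeasure ρ] (g : Ω → ℝ),
        (∀ x, 0 ≤ g x) → (∀ x, g x ≤ 1) → 0 ≤ ∫ x, g x ∂ρ ∧ ∫ x, g x ∂ρ ≤ 1 := by
      intro Ω _ ρ _ g hg0 hg1
      refine ⟨integral_nonneg hg0, ?_⟩
      have := norm_integral_le_of_norm_le_const (μ := ρ) (f := g) (C := 1)
        (ae_of_all _ fun x => by rw [Real.norm_eq_abs, abs_of_nonneg (hg0 x)]; exact hg1 x)
      simp at this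
      exact (abs_le.1 this).2
    have a1 := hbd μ (fun M => h (A * (M : Matrix (Fin n) (Fin n) ℝ)).trace) (fun _ => h0 _) (fun _ => h1 _)
    have a2 := hbd (gaussianReal 0 1) h h0 h1
    calc _ ≤ (1:ℝ) := by rw [abs_le]; constructor <;> linarith [a1.1, a1.2, a2.1, a2.2]
      _ ≤ _ := by rw [le_div_iff₀ (by linarith)]; linarith
  · have := stein_bound μ A h5 (by rw [Matrix.trace_mul_comm]; exact hA) h hc h0 h1
    have e : ∀ M : Matrix.orthogonalGroup (Fin n) ℝ,
        h (A * (M : Matrix (Fin n) (Fin n) ℝ)).trace = h ((M : Matrix (Fin n) (Fin n) ℝ) * A).trace :=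
      fun M => by rw [Matrix.trace_mul_comm]
    simp only [e]
    exact this
end

section
/- Let n ≥ 8, let A be a fixed n × n matrix over ℂ with tr(AA*) = n, let M be a random matrix in the unitary group U(n) distributed according to Haar (probability) measure, and set W = tr(AM). For θ ∈ ℝ let W_θ = Re(e^{−iθ} W) be the inner product of W with the unit vector in ℂ making angle θ with the real axis. Then for every θ, the total variation distance between the law of W_θ and the normal distribution N(0, 1/2) is at most 4/n. -/
open MeasureTheory ProbabilityTheory Matrix

noncomputable instance {n : ℕ} : MeasurableSpace (Matrix.unitaryGroup (Fin n) ℂ) :=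
  borel _

instance {n : ℕ} : BorelSpace (Matrix.unitaryGroup (Fin n) ℂ) := ⟨rfl⟩

section UN
open scoped Matrix.Norms.L2Operator

lemma unitary_compact (n : ℕ) : CompactSpace (Matrix.unitaryGroup (Fin n) ℂ) := by
  suffices h : IsCompact ((Matrix.unitaryGroup (Fin n) ℂ : Submonoid (Matrix (Fin n) (Fin n) ℂ)) :
      Set (Matrix (Fin n) (Fin n) ℂ)) from isCompact_iff_compactSpace.mp h
  have : ProperSpace (Matrix (Fin n) (Fin n) ℂ) := FiniteDimensional.proper ℂ _
  refine Metric.isCompact_of_isClosed_isBounded ?_ ?_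
  · exact isClosed_unitary (R := Matrix (Fin n) (Fin n) ℂ)
  · refine (Metric.isBounded_closedBall (x := (0 : Matrix (Fin n) (Fin n) ℂ)) (r := 1)).subset ?_
    intro M hM
    rw [mem_closedBall_zero_iff]
    by_cases h : Nontrivial (Matrix (Fin n) (Fin n) ℂ)
    · exact (CStarRing.norm_of_mem_unitary hM).le
    · rw [not_nontrivial_iff_subsingleton] at h
      rw [Subsingleton.elim M 0]; simp

lemma hasDerivAt_retr {n : ℕ} {γ : ℝ → Matrix (Fin n) (Fin n) ℂ} {γ' : Matrix (Fin n) (Fin n) ℂ}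
    {t : ℝ} (h : HasDerivAt γ γ' t) :
    HasDerivAt (fun t => (γ t).trace.re) γ'.trace.re t := by
  let L : Matrix (Fin n) (Fin n) ℂ →ₗ[ℝ] ℝ :=
    Complex.reLm ∘ₗ (Matrix.traceLinearMap (Fin n) ℝ ℂ)
  have := (LinearMap.toContinuousLinearMap L).hasFDerivAt.comp_hasDerivAt t h
  exact this

lemma unit_curve {n : ℕ} (B : Matrix (Fin n) (Fin n) ℂ) (hB : Bᴴ = -B) (t : ℝ) :
    NormedSpace.exp (t • B) ∈ Matrix.unitaryGroup (Fin n) ℂ := by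
  let : NormedAlgebra ℚ (Matrix (Fin n) (Fin n) ℂ) := NormedAlgebra.restrictScalars ℚ ℂ _
  apply NormedSpace.exp_mem_unitary_of_mem_skewAdjoint
  rw [skewAdjoint.mem_iff, star_smul, star_eq_conjTranspose, hB]
  simp

lemma curve_deriv {n : ℕ} (B : Matrix (Fin n) (Fin n) ℂ) (M : Matrix (Fin n) (Fin n) ℂ) :
    HasDerivAt (fun t : ℝ => NormedSpace.exp (t • B) * M) (B * M) 0 := by
  have := (hasDerivAt_exp_smul_const (𝕂 := ℝ) B (0 : ℝ)).mul_const M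
  simpa using this

lemma ibp_s3 {n : ℕ} (μ : Measure (Matrix.unitaryGroup (Fin n) ℂ))
    [μ.IsHaarMeasure] [IsProbabilityMeasure μ]
    (B : Matrix (Fin n) (Fin n) ℂ) (hB : Bᴴ = -B)
    (F G : Matrix (Fin n) (Fin n) ℂ → ℝ) (hF : Continuous F) (hG : Continuous G)
    (h : ∀ M, M ∈ Matrix.unitaryGroup (Fin n) ℂ →
      HasDerivAt (fun t : ℝ => F (NormedSpace.exp (t • B) * M)) (G M) 0) :
    ∫ M : Matrix.unitaryGroup (Fin n) ℂ, G M ∂μ = 0 := by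
  have := unitary_compact n
  let u : ℝ → Matrix.unitaryGroup (Fin n) ℂ := fun t => ⟨_, unit_curve B hB t⟩
  have hd : ∀ (M : Matrix.unitaryGroup (Fin n) ℂ) (t : ℝ),
      HasDerivAt (fun t : ℝ => F ((u t * M : Matrix.unitaryGroup (Fin n) ℂ)))
        (G ((u t * M : Matrix.unitaryGroup (Fin n) ℂ))) t := by
    intro M t
    have h1 := h _ (u t * M).2
    have h2 : HasDerivAt (fun s : ℝ => s - t) 1 t := (hasDerivAt_id t).sub_const t
    have h3 := HasDerivAt.scomp_of_eq (h := fun s : ℝ => s - t) t h1 h2 (by simp)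
    simp only [one_smul] at h3
    have e : (fun t : ℝ => F ((u t * M : Matrix.unitaryGroup (Fin n) ℂ))) =
      ((fun t_1 : ℝ => F (NormedSpace.exp (t_1 • B) * ((u t * M : Matrix.unitaryGroup (Fin n) ℂ) : Matrix (Fin n) (Fin n) ℂ))) ∘ fun s => s - t) := ?_
    · rw [e]; exact h3
    ext s
    simp only [Function.comp, u, Submonoid.coe_mul]
    rw [← mul_assoc, ← Matrix.exp_add_of_commute _ _
      ((Commute.refl B).smul_left _ |>.smul_right _), ← add_smul]
    simp
  obtain ⟨K, hK⟩ := (isCompact_univ (X := Matrix.unitaryGroup (Fin n) ℂ)).exists_bound_of_continuousOn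
    (f := fun M : Matrix.unitaryGroup (Fin n) ℂ => G M) (hG.comp continuous_subtype_val).continuousOn
  have cF : Continuous (fun M : Matrix.unitaryGroup (Fin n) ℂ => F M) := hF.comp continuous_subtype_val
  have cG : Continuous (fun M : Matrix.unitaryGroup (Fin n) ℂ => G M) := hG.comp continuous_subtype_val
  have key := hasDerivAt_integral_of_dominated_loc_of_deriv_le (μ := μ) (x₀ := (0:ℝ)) (s := Set.univ)
    (F := fun t M => F ((u t * M : Matrix.unitaryGroup (Fin n) ℂ)))
    (F' := fun t M => G ((u t * M : Matrix.unitaryGroup (Fin n) ℂ))) (bound := fun _ => K)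
    Filter.univ_mem ?_ ?_ ?_ ?_ ?_ ?_
  · have h2 := key.2
    have e1 : ∀ t, ∫ M, F ((u t * M : Matrix.unitaryGroup (Fin n) ℂ)) ∂μ =
        ∫ M : Matrix.unitaryGroup (Fin n) ℂ, F M ∂μ := fun t =>
      integral_mul_left_eq_self (μ := μ) (fun M : Matrix.unitaryGroup (Fin n) ℂ => F M) (u t)
    have e2 : ∫ M, G ((u 0 * M : Matrix.unitaryGroup (Fin n) ℂ)) ∂μ =
        ∫ M : Matrix.unitaryGroup (Fin n) ℂ, G M ∂μ :=
      integral_mul_left_eq_self (μ := μ) (fun M : Matrix.unitaryGroup (Fin n) ℂ => G M) (u 0)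
    simp only [e1, e2] at h2
    exact h2.unique (hasDerivAt_const _ _)
  · refine Filter.Eventually.of_forall fun t => ?_
    exact ((cF.comp (continuous_const_mul (u t))).measurable).aestronglyMeasurable
  · exact (cF.comp (continuous_const_mul (u 0))).integrable_of_hasCompactSupport (HasCompactSupport.of_compactSpace _)
  · exact ((cG.comp (continuous_const_mul (u 0))).measurable).aestronglyMeasurable
  · exact Filter.Eventually.of_forall fun M t _ => hK _ (Set.mem_univ _)
  · exact integrable_const _
  · exact Filter.Eventually.of_forall fun M t _ => hd M t

/-- The Casimir family. -/
noncomputable def cas {n : ℕ} (i : Fin n × Fin n) (b : Bool) : Matrix (Fin n) (Fin n) ℂ :=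
  if b then (1 / 2 : ℂ) • (Matrix.single i.1 i.2 1 - Matrix.single i.2 i.1 1)
  else (Complex.I / 2 : ℂ) • (Matrix.single i.1 i.2 1 + Matrix.single i.2 i.1 1)

lemma cas_skew {n : ℕ} (i : Fin n × Fin n) (b : Bool) : (cas i b)ᴴ = - cas i b := by
  cases b
  · simp only [cas, Bool.false_eq_true, if_false, conjTranspose_smul, conjTranspose_add,
      conjTranspose_single, star_one]
    rw [add_comm, ← neg_smul]
    congr 1
    simp [neg_div]
  · simp only [cas, if_true, conjTranspose_smul, conjTranspose_sub,
      conjTranspose_single, star_one]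
    rw [← smul_neg, neg_sub]
    congr 1
    simp

lemma cas_sum_mul {n : ℕ} (X : Matrix (Fin n) (Fin n) ℂ) :
    ∑ i : Fin n × Fin n, ∑ b : Bool, cas i b * X * cas i b = -(X.trace • (1 : Matrix (Fin n) (Fin n) ℂ)) := by
  have h1 : ∀ i : Fin n × Fin n, ∑ b : Bool, cas i b * X * cas i b =
      -((1/2 : ℂ) • (Matrix.single i.1 i.2 1 * X * Matrix.single i.2 i.1 1
        + Matrix.single i.2 i.1 1 * X * Matrix.single i.1 i.2 1)) := by
    intro i
    have hI : Complex.I / 2 * (Complex.I / 2) = -(1/4) := by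
      rw [div_mul_div_comm, Complex.I_mul_I]; norm_num
    have hc : ∀ (c : ℂ) (Y : Matrix (Fin n) (Fin n) ℂ), (c • Y) * X * (c • Y) = (c * c) • (Y * X * Y) := by
      intro c Y
      simp [smul_smul]
    simp only [Fintype.sum_bool, cas, if_true, Bool.false_eq_true, if_false, hc, hI]
    simp only [add_mul, mul_add, sub_mul, mul_sub]
    module
  simp only [h1, Matrix.single_mul_mul_single, Finset.sum_neg_distrib, ← Finset.smul_sum,
    Finset.sum_add_distrib, Fintype.sum_prod_type]
  congr 1
  ext a b
  simp [Matrix.sum_apply, Matrix.single_apply, Matrix.one_apply, Matrix.trace]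
  by_cases h : a = b
  · subst h
    simp
    ring
  · have h' : ∀ x, ¬ (x = a ∧ x = b) := fun x hx => h (hx.1.symm.trans hx.2)
    simp [h, h']

lemma cas_sum_tr {n : ℕ} (X Y : Matrix (Fin n) (Fin n) ℂ) :
    ∑ i : Fin n × Fin n, ∑ b : Bool, (cas i b * X).trace * (cas i b * Y).trace = -(X * Y).trace := by
  have h1 : ∀ i : Fin n × Fin n, ∑ b : Bool, (cas i b * X).trace * (cas i b * Y).trace =
      -((1/2 : ℂ) * (X i.2 i.1 * Y i.1 i.2 + X i.1 i.2 * Y i.2 i.1)) := by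
    intro i
    have hI : Complex.I / 2 * (Complex.I / 2) = -(1/4) := by
      rw [div_mul_div_comm, Complex.I_mul_I]; norm_num
    simp only [Fintype.sum_bool, cas, if_true, Bool.false_eq_true, if_false, smul_mul_assoc,
       add_mul, sub_mul, trace_smul, trace_add, trace_sub, smul_eq_mul, Matrix.trace_single_mul]
    linear_combination (X i.2 i.1 + X i.1 i.2) * (Y i.2 i.1 + Y i.1 i.2) * hI
  simp only [h1, Finset.sum_neg_distrib, ← Finset.mul_sum, Finset.sum_add_distrib,
    Fintype.sum_prod_type]
  simp only [Matrix.trace, Matrix.diag, Matrix.mul_apply]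
  rw [Finset.sum_comm]
  ring
end UN

lemma cont_retr {n : ℕ} {f : Matrix (Fin n) (Fin n) ℂ → Matrix (Fin n) (Fin n) ℂ}
    (hf : Continuous f) : Continuous fun M => (f M).trace.re :=
  Complex.continuous_re.comp hf.matrix_trace

section UN
open scoped Matrix.Norms.L2Operator

lemma tr_conj {n : ℕ} (X : Matrix (Fin n) (Fin n) ℂ) : (Xᴴ).trace = star X.trace :=
  Matrix.trace_conjTranspose X

lemma cas_sum_sq {n : ℕ} : ∑ i : Fin n × Fin n, ∑ b : Bool, cas i b * cas i b =
    -((n : ℂ) • (1 : Matrix (Fin n) (Fin n) ℂ)) := by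
  have := cas_sum_mul (1 : Matrix (Fin n) (Fin n) ℂ)
  simpa using this

/-- sum of `Re tr (B B X)` -/
lemma cas_sum_bb {n : ℕ} (X : Matrix (Fin n) (Fin n) ℂ) :
    ∑ i : Fin n × Fin n, ∑ b : Bool, (cas i b * (cas i b * X)).trace.re = -(n * X.trace.re) := by
  have h := congrArg (fun Y => (Y * X).trace.re) (cas_sum_sq (n := n))
  simpa [Finset.sum_mul, Matrix.trace_sum, mul_assoc, add_mul] using h

/-- sum of `Re tr (B X B Y)` -/
lemma cas_sum_bxby {n : ℕ} (X Y : Matrix (Fin n) (Fin n) ℂ) :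
    ∑ i : Fin n × Fin n, ∑ b : Bool, (cas i b * X * cas i b * Y).trace.re =
      -(X.trace * Y.trace).re := by
  have h := congrArg (fun Z => (Z * Y).trace.re) (cas_sum_mul X)
  simpa [Finset.sum_mul, Matrix.trace_sum, add_mul] using h

lemma cas_sum_re {n : ℕ} (X : Matrix (Fin n) (Fin n) ℂ) :
    ∑ i : Fin n × Fin n, ∑ b : Bool, (cas i b * X).trace.re ^ 2 =
      ((X * Xᴴ).trace.re - (X * X).trace.re) / 2 := by
  have h1 : ∀ (i : Fin n × Fin n) (b : Bool), (((cas i b * X).trace.re : ℝ) : ℂ) =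
      1 / 2 * (cas i b * (X - Xᴴ)).trace := by
    intro i b
    have e : star (cas i b * X).trace = -(cas i b * Xᴴ).trace := by
      rw [← tr_conj, conjTranspose_mul, cas_skew, Matrix.mul_neg, Matrix.trace_neg,
        Matrix.trace_mul_comm]
    rw [Complex.re_eq_add_conj, starRingEnd_apply, e, mul_sub, Matrix.trace_sub]
    ring
  have h2 := cas_sum_tr (X - Xᴴ) (X - Xᴴ)
  have h3 : ((∑ i : Fin n × Fin n, ∑ b : Bool, (cas i b * X).trace.re ^ 2 : ℝ) : ℂ) =
      1 / 4 * (-((X - Xᴴ) * (X - Xᴴ)).trace) := by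
    rw [← h2]
    push_cast
    simp only [Finset.mul_sum, h1]
    refine Finset.sum_congr rfl fun i _ => Finset.sum_congr rfl fun b _ => ?_
    ring
  have h4 := congrArg Complex.re h3
  have e1 : (Xᴴ * X).trace = (X * Xᴴ).trace := Matrix.trace_mul_comm _ _
  have e2 : (Xᴴ * Xᴴ).trace = star (X * X).trace := by
    rw [← tr_conj, conjTranspose_mul]
  rw [Complex.ofReal_re] at h4
  rw [h4, sub_mul, mul_sub, mul_sub]
  simp only [Matrix.trace_sub, e1, e2]
  have : (1/4 : ℂ) = ((1/4 : ℝ) : ℂ) := by norm_num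
  rw [this, Complex.re_ofReal_mul]
  simp
  ring

lemma normsq_nonneg {n : ℕ} (X : Matrix (Fin n) (Fin n) ℂ) : 0 ≤ (X * Xᴴ).trace.re := by
  simp only [Matrix.trace, Matrix.diag, Matrix.mul_apply, conjTranspose_apply, Complex.re_sum]
  refine Finset.sum_nonneg fun i _ => Finset.sum_nonneg fun j _ => ?_
  rw [Complex.star_def, Complex.mul_conj, Complex.ofReal_re]
  exact Complex.normSq_nonneg _

lemma abs_retr_sq_le {n : ℕ} (X : Matrix (Fin n) (Fin n) ℂ) :
    |(X * X).trace.re| ≤ (X * Xᴴ).trace.re := by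
  have e1 : (Xᴴ * X).trace = (X * Xᴴ).trace := Matrix.trace_mul_comm _ _
  have e2 : (Xᴴ * Xᴴ).trace = star (X * X).trace := by
    rw [← tr_conj, conjTranspose_mul]
  have h1 := normsq_nonneg (X - Xᴴ)
  have h2 := normsq_nonneg (X + Xᴴ)
  simp only [conjTranspose_sub, conjTranspose_add, conjTranspose_conjTranspose, add_mul, mul_add,
    sub_mul, mul_sub, Matrix.trace_sub, Matrix.trace_add, e1, e2] at h1 h2
  simp at h1 h2
  rw [abs_le]
  constructor <;> linarith

variable {n : ℕ} (μ : Measure (Matrix.unitaryGroup (Fin n) ℂ))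
    [μ.IsHaarMeasure] [IsProbabilityMeasure μ]

/-- Summed integration by parts. -/
lemma ibp_sum (F G : Fin n × Fin n → Bool → Matrix (Fin n) (Fin n) ℂ → ℝ)
    (hF : ∀ i b, Continuous (F i b)) (hG : ∀ i b, Continuous (G i b))
    (h : ∀ i b M, M ∈ Matrix.unitaryGroup (Fin n) ℂ →
      HasDerivAt (fun t : ℝ => F i b (NormedSpace.exp (t • cas i b) * M)) (G i b M) 0) :
    ∫ M : Matrix.unitaryGroup (Fin n) ℂ, ∑ i, ∑ b, G i b M ∂μ = 0 := by
  have := unitary_compact n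
  have hi : ∀ i b, Integrable (fun M : Matrix.unitaryGroup (Fin n) ℂ => G i b M) μ := fun i b =>
    ((hG i b).comp continuous_subtype_val).integrable_of_hasCompactSupport
      (HasCompactSupport.of_compactSpace _)
  rw [integral_finsetSum _ fun i _ => integrable_finsetSum _ fun b _ => hi i b]
  refine Finset.sum_eq_zero fun i _ => ?_
  rw [integral_finsetSum _ fun b _ => hi i b]
  exact Finset.sum_eq_zero fun b _ => ibp_s3 μ _ (cas_skew i b) _ _ (hF i b) (hG i b) (h i b)

lemma cont_int {n : ℕ} (μ : Measure (Matrix.unitaryGroup (Fin n) ℂ))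
    [IsProbabilityMeasure μ] {f : Matrix (Fin n) (Fin n) ℂ → ℝ} (hf : Continuous f) :
    Integrable (fun M : Matrix.unitaryGroup (Fin n) ℂ => f M) μ := by
  have := unitary_compact n
  exact (hf.comp continuous_subtype_val).integrable_of_hasCompactSupport
      (HasCompactSupport.of_compactSpace _)

lemma unit_norm (A M : Matrix (Fin n) (Fin n) ℂ) (hM : M ∈ Matrix.unitaryGroup (Fin n) ℂ) :
    ((M * A) * (M * A)ᴴ).trace = (A * Aᴴ).trace := by
  have : Mᴴ * M = 1 := Matrix.mem_unitaryGroup_iff'.mp hM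
  rw [conjTranspose_mul, Matrix.trace_mul_comm, mul_assoc, ← mul_assoc Mᴴ, this, one_mul,
    Matrix.trace_mul_comm]

/-- First identity -/
lemma ident1 (A : Matrix (Fin n) (Fin n) ℂ) (hA : (A * Aᴴ).trace = (n : ℂ))
    (g g' : ℝ → ℝ) (hg : ∀ x, HasDerivAt g (g' x) x) (hg' : Continuous g') :
    ∫ M : Matrix.unitaryGroup (Fin n) ℂ,
      (g' ((M : Matrix (Fin n) (Fin n) ℂ) * A).trace.re *
        ((n - (((M : Matrix (Fin n) (Fin n) ℂ) * A) * ((M : Matrix (Fin n) (Fin n) ℂ) * A)).trace.re) / 2)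
        - n * (g ((M : Matrix (Fin n) (Fin n) ℂ) * A).trace.re *
          ((M : Matrix (Fin n) (Fin n) ℂ) * A).trace.re)) ∂μ = 0 := by
  have cg : Continuous g := continuous_iff_continuousAt.mpr fun x => (hg x).continuousAt
  have := ibp_sum μ (fun i b M => g (M * A).trace.re * (cas i b * (M * A)).trace.re)
    (fun i b M => g' (M * A).trace.re * (cas i b * (M * A)).trace.re ^ 2 +
      g (M * A).trace.re * (cas i b * (cas i b * (M * A))).trace.re)
    (fun i b => by fun_prop) (fun i b => by fun_prop) ?_
  · rw [← this]
    congr 1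
    ext M
    simp only [Finset.sum_add_distrib, ← Finset.mul_sum, cas_sum_re, cas_sum_bb]
    rw [unit_norm A M M.2, hA]
    simp
    ring
  · intro i b M hM
    have hc := (curve_deriv (cas i b) M).mul_const A
    have h1 := hasDerivAt_retr hc
    have h2 := hasDerivAt_retr (hc.const_mul (cas i b))
    have h3 := (HasDerivAt.comp_of_eq (h₂ := g) (0:ℝ) (hg _) h1 rfl).mul h2
    refine h3.congr_deriv ?_
    simp only [zero_smul, NormedSpace.exp_zero, one_mul, Function.comp, mul_assoc]
    ring

/-- Second identity. -/
lemma ident2 (A : Matrix (Fin n) (Fin n) ℂ) :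
    ∫ M : Matrix.unitaryGroup (Fin n) ℂ, (fun C : Matrix (Fin n) (Fin n) ℂ =>
      ((C * C) * (C * C)ᴴ).trace.re - ((C * C) * (C * C)).trace.re
        - (C * C).trace.re * (n * (C * C).trace.re + (C.trace * C.trace).re))
          ((M : Matrix (Fin n) (Fin n) ℂ) * A) ∂μ = 0 := by
  have c1 : Continuous fun M : Matrix (Fin n) (Fin n) ℂ => M * A :=
    continuous_id.matrix_mul continuous_const
  have c2 : Continuous fun M : Matrix (Fin n) (Fin n) ℂ => (M * A) * (M * A) := c1.matrix_mul c1
  have c3 : ∀ i b, Continuous fun M : Matrix (Fin n) (Fin n) ℂ => (cas i b * ((M * A) * (M * A))) :=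
    fun i b => continuous_const.matrix_mul c2
  have := ibp_sum μ (fun i b M => ((M * A) * (M * A)).trace.re *
      (cas i b * ((M * A) * (M * A))).trace.re)
    (fun i b M => 2 * (cas i b * ((M * A) * (M * A))).trace.re ^ 2 +
      ((M * A) * (M * A)).trace.re * ((cas i b * (cas i b * ((M * A) * (M * A)))).trace.re
        + (cas i b * (M * A) * cas i b * (M * A)).trace.re))
    (fun i b => (cont_retr c2).mul (cont_retr (c3 i b)))
    (fun i b => (continuous_const.mul ((cont_retr (c3 i b)).pow 2)).add
      ((cont_retr c2).mul ((cont_retr (continuous_const.matrix_mul (c3 i b))).add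
        (cont_retr (((continuous_const.matrix_mul c1).matrix_mul continuous_const).matrix_mul c1))))) ?_
  · rw [← this]
    congr 1
    ext M
    simp only [Finset.sum_add_distrib, ← Finset.mul_sum, cas_sum_re, cas_sum_bb, cas_sum_bxby]
    ring
  · intro i b M hM
    have hc := (curve_deriv (cas i b) M).mul_const A
    have h1 := hasDerivAt_retr (hc.mul hc)
    have h2 := hasDerivAt_retr ((hc.mul hc).const_mul (cas i b))
    have h3 := h1.mul h2
    refine h3.congr_deriv ?_
    have e : (M * A * (cas i b * M * A)).trace = (cas i b * (M * A * (M * A))).trace := by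
      rw [Matrix.trace_mul_comm]; simp only [mul_assoc]
    simp only [zero_smul, NormedSpace.exp_zero, one_mul, Matrix.trace_add, mul_add, Complex.add_re,
      e, Pi.mul_apply]
    simp only [mul_assoc]
    ring

/-- Third identity. -/
lemma ident3 (P Q : Matrix (Fin n) (Fin n) ℂ) :
    ∫ M : Matrix.unitaryGroup (Fin n) ℂ, (fun M : Matrix (Fin n) (Fin n) ℂ =>
      2 * (P.trace * Q.trace).re - 2 * n * (M * P * Mᴴ * Q).trace.re) M ∂μ = 0 := by
  have c1 : Continuous fun M : Matrix (Fin n) (Fin n) ℂ => M * P * Mᴴ :=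
    (continuous_id.matrix_mul continuous_const).matrix_mul continuous_id.matrix_conjTranspose
  have c2 : Continuous fun M : Matrix (Fin n) (Fin n) ℂ => M * P * Mᴴ * Q :=
    c1.matrix_mul continuous_const
  have c3 : Continuous fun M : Matrix (Fin n) (Fin n) ℂ => Q * (M * P * Mᴴ) :=
    continuous_const.matrix_mul c1
  have := ibp_sum μ
    (fun i b M => (cas i b * (M * P * Mᴴ * Q - Q * (M * P * Mᴴ))).trace.re)
    (fun i b M => (cas i b * (cas i b * (M * P * Mᴴ * Q))).trace.re
      + (cas i b * (cas i b * (Q * (M * P * Mᴴ)))).trace.re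
      - (cas i b * (M * P * Mᴴ) * cas i b * Q).trace.re
      - (cas i b * Q * cas i b * (M * P * Mᴴ)).trace.re)
    (fun i b => cont_retr (continuous_const.matrix_mul (c2.sub c3)))
    (fun i b => (((cont_retr (continuous_const.matrix_mul (continuous_const.matrix_mul c2))).add
      (cont_retr (continuous_const.matrix_mul (continuous_const.matrix_mul c3)))).sub
      (cont_retr (((continuous_const.matrix_mul c1).matrix_mul continuous_const).matrix_mul
        continuous_const))).sub
      (cont_retr (continuous_const.matrix_mul c1))) ?_
  · rw [← this]
    congr 1
    ext M
    have e1 : ((M : Matrix (Fin n) (Fin n) ℂ) * P * (M : Matrix (Fin n) (Fin n) ℂ)ᴴ).trace = P.trace := by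
      have : (M : Matrix (Fin n) (Fin n) ℂ)ᴴ * M = 1 := Matrix.mem_unitaryGroup_iff'.mp M.2
      rw [Matrix.trace_mul_comm, ← mul_assoc, this, one_mul]
    simp only [Finset.sum_add_distrib, Finset.sum_sub_distrib, cas_sum_bb, cas_sum_bxby, e1]
    rw [Matrix.trace_mul_comm Q, mul_comm Q.trace]
    ring
  · intro i b M hM
    have hc := (curve_deriv (cas i b) M)
    have hs : HasDerivAt (fun t : ℝ => (NormedSpace.exp (t • cas i b) * M)ᴴ) (cas i b * M)ᴴ 0 := hc.star
    have hH := (hc.mul_const P).mul hs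
    have h1 := hasDerivAt_retr (((hH.mul_const Q).sub (hH.const_mul Q)).const_mul (cas i b))
    refine h1.congr_deriv ?_
    simp only [zero_smul, NormedSpace.exp_zero, one_mul, conjTranspose_mul, cas_skew, mul_neg,
      neg_mul, mul_add, add_mul, mul_sub, Matrix.trace_add, Matrix.trace_sub, Matrix.trace_neg,
      Complex.add_re, Complex.sub_re, Complex.neg_re]
    have e : (cas i b * (Q * (M * P * (Mᴴ * cas i b)))).trace =
      (cas i b * (cas i b * (Q * (M * P * Mᴴ)))).trace := by
      have : cas i b * (Q * (M * P * (Mᴴ * cas i b))) = (cas i b * (Q * (M * P * Mᴴ))) * cas i b := by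
        simp only [mul_assoc]
      rw [this, Matrix.trace_mul_comm]
    rw [e]
    simp only [mul_assoc]
    ring
end UN

lemma tv_of_cont (P Q : Measure ℝ) [IsProbabilityMeasure P] [IsProbabilityMeasure Q] (ε : ℝ)
    (H : ∀ h : ℝ → ℝ, Continuous h → (∀ x, 0 ≤ h x) → (∀ x, h x ≤ 1) →
      |∫ x, h x ∂P - ∫ x, h x ∂Q| ≤ ε) (s : Set ℝ) (hs : MeasurableSet s) :
    |(P s).toReal - (Q s).toReal| ≤ ε := by
  have hcl : ∀ K : Set ℝ, IsClosed K → |(P K).toReal - (Q K).toReal| ≤ ε := by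
    intro K hK
    have hlim : ∀ ν : Measure ℝ, IsProbabilityMeasure ν →
        Filter.Tendsto (fun n => ∫ x, ((hK.apprSeq n x : NNReal) : ℝ) ∂ν) Filter.atTop (nhds (ν K).toReal) := by
      intro ν hν
      have h1 := HasOuterApproxClosed.tendsto_lintegral_apprSeq hK ν
      have h2 := (ENNReal.tendsto_toReal (measure_ne_top ν K)).comp h1
      refine h2.congr fun n => ?_
      simp only [Function.comp]
      rw [integral_eq_lintegral_of_nonneg_ae (Filter.Eventually.of_forall fun x => NNReal.coe_nonneg _)
        (NNReal.continuous_coe.comp (hK.apprSeq n).continuous).aestronglyMeasurable]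
      simp
    refine le_of_tendsto ((hlim P inferInstance).sub (hlim Q inferInstance)).abs
      (Filter.Eventually.of_forall fun n => H (fun x => ((hK.apprSeq n x : NNReal) : ℝ))
        (NNReal.continuous_coe.comp (hK.apprSeq n).continuous) (fun x => NNReal.coe_nonneg _) fun x => ?_)
    exact_mod_cast HasOuterApproxClosed.apprSeq_apply_le_one hK n x
  have one : ∀ (P Q : Measure ℝ), IsProbabilityMeasure P → IsProbabilityMeasure Q →
      (∀ K : Set ℝ, IsClosed K → |(P K).toReal - (Q K).toReal| ≤ ε) →
      (P s).toReal - (Q s).toReal ≤ ε := by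
    intro P Q _ _ hc
    refine le_of_forall_pos_le_add fun δ hδ => ?_
    obtain ⟨K, hKs, hK, hlt⟩ := hs.exists_isClosed_lt_add (μ := P) (measure_ne_top _ _)
      (ε := ENNReal.ofReal δ) (by simpa using hδ)
    have h1 : (P s).toReal ≤ (P K).toReal + δ := by
      have := ENNReal.toReal_mono (by finiteness) hlt.le
      rwa [ENNReal.toReal_add (by finiteness) (by finiteness), ENNReal.toReal_ofReal hδ.le] at this
    have h2 : (Q K).toReal ≤ (Q s).toReal :=
      ENNReal.toReal_mono (measure_ne_top _ _) (measure_mono hKs)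
    have h3 := (abs_le.mp (hc K hK)).2
    linarith
  rw [abs_le]
  have a := one P Q inferInstance inferInstance hcl
  have b := one Q P inferInstance inferInstance (fun K hK => by rw [abs_sub_comm]; exact hcl K hK)
  constructor <;> linarith

lemma exp_deriv (x : ℝ) : HasDerivAt (fun y : ℝ => -(1 / 2) * Real.exp (-1 * y ^ 2))
    (x * Real.exp (-1 * x ^ 2)) x := by
  have h := (((hasDerivAt_pow 2 x).const_mul (-1 : ℝ)).exp).const_mul (-(1 / 2) : ℝ)
  refine h.congr_deriv ?_
  simp
  ring

lemma tail_right (x : ℝ) : ∫ y in Set.Ioi x, y * Real.exp (-1 * y ^ 2) = 1 / 2 * Real.exp (-1 * x ^ 2) := by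
  have hi := integrable_mul_exp_neg_mul_sq (b := 1) one_pos
  rw [integral_Ioi_of_hasDerivAt_of_tendsto' (fun y _ => exp_deriv y) hi.integrableOn (m := 0)]
  · ring
  · have : Filter.Tendsto (fun y : ℝ => -1 * y ^ 2) Filter.atTop Filter.atBot :=
      (Filter.tendsto_pow_atTop two_ne_zero).const_mul_atTop_of_neg (by norm_num)
    simpa using (Real.tendsto_exp_atBot.comp this).const_mul (-(1/2) : ℝ)

lemma tail_left (x : ℝ) : ∫ y in Set.Iic x, y * Real.exp (-1 * y ^ 2) = -(1 / 2 * Real.exp (-1 * x ^ 2)) := by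
  have hi := integrable_mul_exp_neg_mul_sq (b := 1) one_pos
  rw [integral_Iic_of_hasDerivAt_of_tendsto' (fun y _ => exp_deriv y) hi.integrableOn (m := 0)]
  · ring
  · have : Filter.Tendsto (fun y : ℝ => -1 * y ^ 2) Filter.atBot Filter.atBot :=
by
      have h := (Filter.tendsto_pow_atTop (α := ℝ) two_ne_zero).comp Filter.tendsto_neg_atBot_atTop
      refine (h.const_mul_atTop_of_neg (show (-1 : ℝ) < 0 by norm_num)).congr fun y => ?_
      simp
    simpa using (Real.tendsto_exp_atBot.comp this).const_mul (-(1/2) : ℝ)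

lemma stein (h : ℝ → ℝ) (hc : Continuous h) (h0 : ∀ x, 0 ≤ h x) (h1 : ∀ x, h x ≤ 1) :
    ∃ g g' : ℝ → ℝ, (∀ x, HasDerivAt g (g' x) x) ∧ Continuous g' ∧ (∀ x, |g' x| ≤ 4) ∧
      ∀ x, 1 / 2 * g' x - x * g x = h x - ∫ y, h y ∂(gaussianReal 0 (1 / 2)) := by
  set c := ∫ y, h y ∂(gaussianReal 0 (1 / 2)) with hcdef
  have hIntH : Integrable h (gaussianReal 0 (1 / 2)) :=
    Integrable.of_bound hc.aestronglyMeasurable 1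
      (Filter.Eventually.of_forall fun x => by rw [Real.norm_of_nonneg (h0 x)]; exact h1 x)
  have c0 : 0 ≤ c := integral_nonneg h0
  have c1 : c ≤ 1 := by
    have := integral_mono hIntH (integrable_const (1:ℝ)) h1
    simpa only [integral_const, probReal_univ, one_smul] using this
  have hk : ∀ x, |h x - c| ≤ 1 := fun x => abs_le.mpr ⟨by linarith [h0 x], by linarith [h1 x]⟩
  have hv : (1 / 2 : NNReal) ≠ 0 := by norm_num
  set w : ℝ → ℝ := fun y => (h y - c) * Real.exp (-1 * y ^ 2) with hw
  have ce : Continuous fun y : ℝ => Real.exp (-1 * y ^ 2) := by fun_prop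
  have cw : Continuous w := by fun_prop
  have ie := integrable_exp_neg_mul_sq (b := 1) one_pos
  have iw : Integrable w := by
    refine ie.mono cw.aestronglyMeasurable (Filter.Eventually.of_forall fun x => ?_)
    rw [hw, norm_mul]
    exact mul_le_of_le_one_left (norm_nonneg _) (hk x)
  have tot : ∫ y, w y = 0 := by
    have e1 : ∫ y, (h y - c) ∂(gaussianReal 0 (1 / 2)) = 0 := by
      rw [integral_sub hIntH (integrable_const _)]
      simp only [integral_const, probReal_univ, one_smul, ← hcdef, sub_self]
    rw [integral_gaussianReal_eq_integral_smul hv] at e1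
    have e2 : ∀ y, gaussianPDFReal 0 (1 / 2) y • (h y - c) = (√Real.pi)⁻¹ * w y := by
      intro y
      have p1 : 2 * Real.pi * ((1 / 2 : NNReal) : ℝ) = Real.pi := by push_cast; ring
      have p2 : -(y - 0) ^ 2 / (2 * ((1 / 2 : NNReal) : ℝ)) = -1 * y ^ 2 := by push_cast; ring
      rw [gaussianPDFReal, p1, p2, smul_eq_mul, hw]
      ring
    simp only [e2] at e1
    rw [integral_const_mul] at e1
    rcases mul_eq_zero.mp e1 with h | h
    · exact absurd h (by positivity)
    · exact h
  set G : ℝ → ℝ := fun x => ∫ y in Set.Iic x, w y with hG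
  have dG : ∀ x, HasDerivAt G (w x) x := by
    intro x
    have e : G = fun x => G 0 + ∫ y in (0:ℝ)..x, w y := by
      ext x
      rw [← intervalIntegral.integral_Iic_sub_Iic iw.integrableOn iw.integrableOn]
      simp [hG]
    rw [e]
    exact (intervalIntegral.integral_hasDerivAt_right (iw.intervalIntegrable)
      (cw.stronglyMeasurableAtFilter _ _) cw.continuousAt).const_add _
  have bG : ∀ x, |x * G x| ≤ 1 / 2 * Real.exp (-1 * x ^ 2) := by
    intro x
    have im := integrable_mul_exp_neg_mul_sq (b := 1) one_pos
    rcases le_total x 0 with hx | hx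
    · have : x * G x = ∫ y in Set.Iic x, x * w y := by rw [integral_const_mul]
      rw [this]
      have e : 1 / 2 * Real.exp (-1 * x ^ 2) = ∫ y in Set.Iic x, -(y * Real.exp (-1 * y ^ 2)) := by
        rw [integral_neg, tail_left, neg_neg]
      rw [e]
      rw [← Real.norm_eq_abs]
      refine norm_integral_le_of_norm_le
        (show IntegrableOn (fun y => -(y * Real.exp (-1 * y ^ 2))) (Set.Iic x) volume from
          im.neg.integrableOn) ?_
      refine (ae_restrict_iff' measurableSet_Iic).mpr (Filter.Eventually.of_forall fun y hy => ?_)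
      rw [Set.mem_Iic] at hy
      rw [hw, norm_mul, norm_mul, Real.norm_of_nonpos hx, Real.norm_of_nonneg (Real.exp_pos _).le,
        ← neg_mul, ← mul_assoc]
      refine mul_le_mul_of_nonneg_right ?_ (Real.exp_pos _).le
      have := hk y
      rw [← Real.norm_eq_abs] at this
      nlinarith [norm_nonneg (h y - c)]
    · have : x * G x = -∫ y in Set.Ioi x, x * w y := by
        rw [integral_const_mul]
        have := intervalIntegral.integral_Iic_add_Ioi (b := x) iw.integrableOn iw.integrableOn
        rw [tot] at this
        have e : G x = -∫ y in Set.Ioi x, w y := by rw [hG]; linarith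
        rw [e]; ring
      rw [this, abs_neg, ← tail_right]
      rw [← Real.norm_eq_abs]
      refine norm_integral_le_of_norm_le im.integrableOn ?_
      refine (ae_restrict_iff' measurableSet_Ioi).mpr (Filter.Eventually.of_forall fun y hy => ?_)
      rw [Set.mem_Ioi] at hy
      rw [hw, norm_mul, norm_mul, Real.norm_of_nonneg hx, Real.norm_of_nonneg (Real.exp_pos _).le,
        ← mul_assoc]
      refine mul_le_mul_of_nonneg_right ?_ (Real.exp_pos _).le
      have := hk y
      rw [← Real.norm_eq_abs] at this
      nlinarith [norm_nonneg (h y - c)]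
  have cG : Continuous G := continuous_iff_continuousAt.mpr fun x => (dG x).continuousAt
  have ee : ∀ x : ℝ, Real.exp (x ^ 2) * Real.exp (-1 * x ^ 2) = 1 := by
    intro x; rw [← Real.exp_add]; simp
  refine ⟨fun x => 2 * (Real.exp (x ^ 2) * G x),
    fun x => 2 * (x * (2 * (Real.exp (x ^ 2) * G x)) + (h x - c)), ?_, by fun_prop, ?_, ?_⟩
  · intro x
    have := (((hasDerivAt_pow 2 x).exp).mul (dG x)).const_mul (2 : ℝ)
    refine this.congr_deriv ?_
    simp only [hw]
    have := ee x
    simp only [Nat.cast_ofNat, Nat.add_one_sub_one, pow_one]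
    linear_combination 2 * (h x - c) * this
  · intro x
    have hb : |x * (2 * (Real.exp (x ^ 2) * G x))| ≤ 1 := by
      have : x * (2 * (Real.exp (x ^ 2) * G x)) = 2 * Real.exp (x ^ 2) * (x * G x) := by ring
      rw [this, abs_mul, abs_of_pos (by positivity)]
      calc _ ≤ 2 * Real.exp (x ^ 2) * (1 / 2 * Real.exp (-1 * x ^ 2)) :=
            mul_le_mul_of_nonneg_left (bG x) (by positivity)
        _ = 1 := by linear_combination ee x
    have := hk x
    rw [abs_le] at *
    constructor <;> linarith
  · intro x
    ring

section Fin

/-- `Re tr (C C)` has second moment at most `3`. -/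
lemma second_moment {n : ℕ} (hn : 0 < n) (μ : Measure (Matrix.unitaryGroup (Fin n) ℂ))
    [μ.IsHaarMeasure] [IsProbabilityMeasure μ]
    (A : Matrix (Fin n) (Fin n) ℂ) (hA : (A * Aᴴ).trace = (n : ℂ)) :
    ∫ M : Matrix.unitaryGroup (Fin n) ℂ, (fun M : Matrix (Fin n) (Fin n) ℂ =>
      ((M * A) * (M * A)).trace.re ^ 2) M ∂μ ≤ 3 := by
  have hn' : (0 : ℝ) < n := by exact_mod_cast hn
  have c1 : Continuous fun M : Matrix (Fin n) (Fin n) ℂ => M * A :=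
    continuous_id.matrix_mul continuous_const
  have c2 : Continuous fun M : Matrix (Fin n) (Fin n) ℂ => (M * A) * (M * A) := c1.matrix_mul c1
  have cH : Continuous fun M : Matrix (Fin n) (Fin n) ℂ => M * (A * Aᴴ) * Mᴴ * (Aᴴ * A) :=
    ((continuous_id.matrix_mul continuous_const).matrix_mul
      continuous_id.matrix_conjTranspose).matrix_mul continuous_const
  have cX : Continuous fun M : Matrix (Fin n) (Fin n) ℂ => (M * A).trace.re := cont_retr c1
  have cY : Continuous fun M : Matrix (Fin n) (Fin n) ℂ => (M * A).trace.im :=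
    Complex.continuous_im.comp c1.matrix_trace
  have cR := cont_retr c2
  have cN := cont_retr cH
  have iX := cont_int μ (cX.pow 2)
  have iY := cont_int μ (cY.pow 2)
  have iR := cont_int μ cR
  have iR2 : Integrable (fun M : Matrix.unitaryGroup (Fin n) ℂ =>
      (((M : Matrix (Fin n) (Fin n) ℂ) * A) * ((M : Matrix (Fin n) (Fin n) ℂ) * A)).trace.re ^ 2) μ :=
    cont_int μ (cR.pow 2)
  have iXY : Integrable (fun M : Matrix.unitaryGroup (Fin n) ℂ =>
      ((M : Matrix (Fin n) (Fin n) ℂ) * A).trace.re ^ 2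
        + ((M : Matrix (Fin n) (Fin n) ℂ) * A).trace.im ^ 2) μ := iX.add iY
  have iN := cont_int μ cN
  -- variance of the trace
  have v1 := ident1 μ A hA id (fun _ => 1) (fun x => hasDerivAt_id x) continuous_const
  have hA' : ((Complex.I • A) * (Complex.I • A)ᴴ).trace = (n : ℂ) := by
    rw [conjTranspose_smul, smul_mul_smul_comm]
    simpa using hA
  have v2 := ident1 μ (Complex.I • A) hA' id (fun _ => 1) (fun x => hasDerivAt_id x) continuous_const
  have hI : ∀ M : Matrix (Fin n) (Fin n) ℂ, (M * A).trace.re ^ 2 + (M * A).trace.im ^ 2 =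
     1 - 1 / n * ((1 * ((n - ((M * A) * (M * A)).trace.re) / 2) - n * (id (M * A).trace.re * (M * A).trace.re))
      + (1 * ((n - ((M * (Complex.I • A)) * (M * (Complex.I • A))).trace.re) / 2)
        - n * (id (M * (Complex.I • A)).trace.re * (M * (Complex.I • A)).trace.re))) := by
    intro M
    have e1 : (M * (Complex.I • A)) * (M * (Complex.I • A)) = -((M * A) * (M * A)) := by
      rw [mul_smul_comm, smul_mul_smul_comm, Complex.I_mul_I, neg_one_smul]
    rw [e1, mul_smul_comm]
    simp
    field_simp
    ring
  have cIA : Continuous fun M : Matrix (Fin n) (Fin n) ℂ => M * (Complex.I • A) :=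
    continuous_id.matrix_mul continuous_const
  have vXY : ∫ M : Matrix.unitaryGroup (Fin n) ℂ, (((M : Matrix (Fin n) (Fin n) ℂ) * A).trace.re ^ 2
      + ((M : Matrix (Fin n) (Fin n) ℂ) * A).trace.im ^ 2) ∂μ = 1 := by
    simp only [hI]
    have j1 := cont_int μ (f := fun M => (1 * ((n - ((M * A) * (M * A)).trace.re) / 2) - n * (id (M * A).trace.re * (M * A).trace.re)))
      (by simp only [id]; fun_prop)
    have j2 := cont_int μ (f := fun M => (1 * ((n - ((M * (Complex.I • A)) * (M * (Complex.I • A))).trace.re) / 2)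
        - n * (id (M * (Complex.I • A)).trace.re * (M * (Complex.I • A)).trace.re)))
      (by 
        have := cont_retr (cIA.matrix_mul cIA)
        have := cont_retr cIA
        simp only [id]; fun_prop)
    have k := integral_sub (integrable_const (1 : ℝ)) ((j1.add j2).const_mul (1 / n : ℝ))
    have k2 := integral_add j1 j2
    rw [v1, v2] at k2
    rw [integral_const_mul] at k
    simp only [Pi.add_apply] at k
    rw [k2] at k
    simp only [integral_const, probReal_univ, one_smul, add_zero, mul_zero, sub_zero] at k
    exact k
  -- the fourth order term
  have w := ident3 μ (A * Aᴴ) (Aᴴ * A)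
  have vN : ∫ M : Matrix.unitaryGroup (Fin n) ℂ,
      (fun M : Matrix (Fin n) (Fin n) ℂ => (M * (A * Aᴴ) * Mᴴ * (Aᴴ * A)).trace.re) M ∂μ = n := by
    simp only at w
    rw [integral_sub (integrable_const _) (iN.const_mul _), integral_const_mul,
      Matrix.trace_mul_comm Aᴴ, hA] at w
    simp only [integral_const, probReal_univ, one_smul, Complex.mul_re, Complex.natCast_re, Complex.natCast_im, mul_zero, sub_zero] at w
    rw [integral_const_mul] at w
    simp only
    have : (2 * n : ℝ) ≠ 0 := by positivity
    apply mul_left_cancel₀ this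
    linarith
  have id2 := ident2 μ A
  have pt : ∀ M : Matrix.unitaryGroup (Fin n) ℂ,
      n * (((M : Matrix (Fin n) (Fin n) ℂ) * A) * ((M : Matrix (Fin n) (Fin n) ℂ) * A)).trace.re ^ 2 + (fun C : Matrix (Fin n) (Fin n) ℂ =>
      ((C * C) * (C * C)ᴴ).trace.re - ((C * C) * (C * C)).trace.re
        - (C * C).trace.re * (n * (C * C).trace.re + (C.trace * C.trace).re))
          ((M : Matrix (Fin n) (Fin n) ℂ) * A) ≤
      2 * (M * (A * Aᴴ) * (M : Matrix (Fin n) (Fin n) ℂ)ᴴ * (Aᴴ * A)).trace.re +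
      n * (((M : Matrix (Fin n) (Fin n) ℂ) * A).trace.re ^ 2
      + ((M : Matrix (Fin n) (Fin n) ℂ) * A).trace.im ^ 2) := by
    intro M
    have q1 := abs_le.mp (abs_retr_sq_le ((M : Matrix (Fin n) (Fin n) ℂ) * A * ((M : Matrix (Fin n) (Fin n) ℂ) * A)))
    have q2 := abs_le.mp (abs_retr_sq_le ((M : Matrix (Fin n) (Fin n) ℂ) * A))
    rw [unit_norm A M M.2, hA, Complex.natCast_re] at q2
    have e : ((M : Matrix (Fin n) (Fin n) ℂ) * A * ((M : Matrix (Fin n) (Fin n) ℂ) * A) * ((M : Matrix (Fin n) (Fin n) ℂ) * A * ((M : Matrix (Fin n) (Fin n) ℂ) * A))ᴴ).trace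
      = (M * (A * Aᴴ) * (M : Matrix (Fin n) (Fin n) ℂ)ᴴ * (Aᴴ * A)).trace := by
      have hM : (M : Matrix (Fin n) (Fin n) ℂ)ᴴ * M = 1 := Matrix.mem_unitaryGroup_iff'.mp M.2
      have : ((M : Matrix (Fin n) (Fin n) ℂ) * A * ((M : Matrix (Fin n) (Fin n) ℂ) * A) * ((M : Matrix (Fin n) (Fin n) ℂ) * A * ((M : Matrix (Fin n) (Fin n) ℂ) * A))ᴴ)
        = ((M : Matrix (Fin n) (Fin n) ℂ) * A) * ((M * (A * Aᴴ) * (M : Matrix (Fin n) (Fin n) ℂ)ᴴ * Aᴴ)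
          * (M : Matrix (Fin n) (Fin n) ℂ)ᴴ) := by
        simp only [conjTranspose_mul, mul_assoc]
      rw [this, Matrix.trace_mul_comm]
      congr 1
      simp only [mul_assoc]
      rw [← mul_assoc _ _ A, hM, one_mul]
    rw [← e]
    simp only [Complex.mul_re]
    set R := ((M : Matrix (Fin n) (Fin n) ℂ) * A * ((M : Matrix (Fin n) (Fin n) ℂ) * A)).trace.re
    set X := ((M : Matrix (Fin n) (Fin n) ℂ) * A).trace.re
    set Y := ((M : Matrix (Fin n) (Fin n) ℂ) * A).trace.im
    nlinarith [mul_nonneg (sub_nonneg.mpr q2.2) (sq_nonneg Y), mul_nonneg (sub_nonneg.mpr q2.2) (sq_nonneg X),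
      mul_nonneg (sub_nonneg.mpr q2.1) (sq_nonneg X), mul_nonneg (sub_nonneg.mpr q2.1) (sq_nonneg Y)]
  have iid2 := cont_int μ (f := fun M => (fun C : Matrix (Fin n) (Fin n) ℂ =>
      ((C * C) * (C * C)ᴴ).trace.re - ((C * C) * (C * C)).trace.re
        - (C * C).trace.re * (n * (C * C).trace.re + (C.trace * C.trace).re)) (M * A)) (by
    have k1 := cont_retr (c2.matrix_mul c2.matrix_conjTranspose)
    have k2 := cont_retr (c2.matrix_mul c2)
    simp only [Complex.mul_re]
    fun_prop)
  have fin := integral_mono ((iR2.const_mul (n:ℝ)).add iid2) ((iN.const_mul 2).add (iXY.const_mul (n:ℝ))) pt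
  simp only [Pi.add_apply] at fin
  rw [integral_add (iR2.const_mul (n:ℝ)) iid2, id2, integral_add (iN.const_mul 2) (iXY.const_mul (n:ℝ)),
    integral_const_mul, integral_const_mul, integral_const_mul, vN] at fin
  rw [vXY] at fin
  have : (n : ℝ) * ∫ M : Matrix.unitaryGroup (Fin n) ℂ, (fun M : Matrix (Fin n) (Fin n) ℂ =>
      ((M * A) * (M * A)).trace.re ^ 2) M ∂μ ≤ n * 3 := by
    simp only at fin ⊢
    linarith
  exact le_of_mul_le_mul_left this hn'

lemma smooth_bound {n : ℕ} (hn : 0 < n) (μ : Measure (Matrix.unitaryGroup (Fin n) ℂ))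
    [μ.IsHaarMeasure] [IsProbabilityMeasure μ]
    (A : Matrix (Fin n) (Fin n) ℂ) (hA : (A * Aᴴ).trace = (n : ℂ))
    (h : ℝ → ℝ) (hc : Continuous h) (h0 : ∀ x, 0 ≤ h x) (h1 : ∀ x, h x ≤ 1) :
    |∫ M : Matrix.unitaryGroup (Fin n) ℂ, h ((M : Matrix (Fin n) (Fin n) ℂ) * A).trace.re ∂μ -
      ∫ y, h y ∂(gaussianReal 0 (1 / 2))| ≤ 4 / n := by
  have hn' : (0 : ℝ) < n := by exact_mod_cast hn
  obtain ⟨g, g', hg, cg', bg, eq⟩ := stein h hc h0 h1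
  set c := ∫ y, h y ∂(gaussianReal 0 (1 / 2))
  have cg : Continuous g := continuous_iff_continuousAt.mpr fun x => (hg x).continuousAt
  have c1 : Continuous fun M : Matrix (Fin n) (Fin n) ℂ => M * A :=
    continuous_id.matrix_mul continuous_const
  have cX := cont_retr c1
  have cR := cont_retr (c1.matrix_mul c1)
  have i1 := ident1 μ A hA g g' hg cg'
  have m2 := second_moment hn μ A hA
  have iR2 := cont_int μ (cR.pow 2)
  have ih := cont_int μ (hc.comp cX)
  have iI := cont_int μ (f := fun M => (g' (M * A).trace.re *
        ((n - ((M * A) * (M * A)).trace.re) / 2)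
        - n * (g (M * A).trace.re * (M * A).trace.re))) (by fun_prop)
  have iE := cont_int μ (f := fun M => 1 / (2 * n) * (g' (M * A).trace.re * ((M * A) * (M * A)).trace.re)) (by fun_prop)
  have e1 : ∫ M : Matrix.unitaryGroup (Fin n) ℂ, h ((M : Matrix (Fin n) (Fin n) ℂ) * A).trace.re ∂μ - c =
      ∫ M : Matrix.unitaryGroup (Fin n) ℂ, (fun M : Matrix (Fin n) (Fin n) ℂ =>
        1 / (2 * n) * (g' (M * A).trace.re * ((M * A) * (M * A)).trace.re)) M ∂μ := by
    have : ∫ M : Matrix.unitaryGroup (Fin n) ℂ, h ((M : Matrix (Fin n) (Fin n) ℂ) * A).trace.re ∂μ - c =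
      ∫ M : Matrix.unitaryGroup (Fin n) ℂ, (h ((M : Matrix (Fin n) (Fin n) ℂ) * A).trace.re - c) ∂μ := by
      have := integral_sub ih (integrable_const c)
      simp only [Function.comp, integral_const, probReal_univ, one_smul] at this
      exact this.symm
    rw [this]
    have h2 := integral_add (iI.const_mul (1 / n : ℝ)) iE
    rw [integral_const_mul, i1, mul_zero, zero_add] at h2
    rw [← h2]
    congr 1
    ext M
    rw [← eq]
    field_simp
    ring
  rw [e1]
  have ib : Integrable (fun M : Matrix.unitaryGroup (Fin n) ℂ => (1 / n : ℝ) * ((fun M : Matrix (Fin n) (Fin n) ℂ =>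
      ((M * A) * (M * A)).trace.re ^ 2) M + 1)) μ := (iR2.add (integrable_const 1)).const_mul _
  rw [← Real.norm_eq_abs]
  refine (norm_integral_le_of_norm_le ib (Filter.Eventually.of_forall fun M => ?_)).trans ?_
  · simp only
    have b1 := bg ((M : Matrix (Fin n) (Fin n) ℂ) * A).trace.re
    set r := g' ((M : Matrix (Fin n) (Fin n) ℂ) * A).trace.re
    set R := ((M : Matrix (Fin n) (Fin n) ℂ) * A * (M * A)).trace.re
    rw [Real.norm_eq_abs, abs_mul, abs_of_pos (by positivity), abs_mul]
    have : |r| * |R| ≤ 2 * (R ^ 2 + 1) := by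
      have : |r| * |R| ≤ 4 * |R| := mul_le_mul_of_nonneg_right b1 (abs_nonneg _)
      nlinarith [sq_nonneg (|R| - 1), sq_abs R]
    calc 1 / (2 * n : ℝ) * (|r| * |R|) ≤ 1 / (2 * n : ℝ) * (2 * (R ^ 2 + 1)) :=
          mul_le_mul_of_nonneg_left this (by positivity)
      _ = _ := by field_simp
  · have i2 : Integrable (fun M : Matrix.unitaryGroup (Fin n) ℂ => (fun M : Matrix (Fin n) (Fin n) ℂ =>
      ((M * A) * (M * A)).trace.re ^ 2) M) μ := iR2
    rw [integral_const_mul, integral_add i2 (integrable_const _)]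
    simp only [integral_const, probReal_univ, one_smul] at m2 ⊢
    rw [div_mul_eq_mul_div, one_mul]
    exact div_le_div_of_nonneg_right (by linarith) hn'.le
end Fin

/-- For `M` Haar-distributed on `U(n)`, `A` fixed with `tr (A A*) = n`,
`W = tr (A M)` and `W_θ = Re (e^{-iθ} W)`, the law of `W_θ` is within total
variation distance `4/n` of `N(0, 1/2)`, for every `θ`, provided `n ≥ 8`. -/
theorem tv_bound_trace_unitary (n : ℕ) (hn : 8 ≤ n)
    (A : Matrix (Fin n) (Fin n) ℂ) (hA : (A * Aᴴ).trace = (n : ℂ))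
    (μ : Measure (Matrix.unitaryGroup (Fin n) ℂ))
    [μ.IsHaarMeasure] [IsProbabilityMeasure μ] (θ : ℝ) :
    ∀ s : Set ℝ, MeasurableSet s →
      |((μ.map (fun M : Matrix.unitaryGroup (Fin n) ℂ =>
            (Complex.exp (-(θ : ℂ) * Complex.I) *
              (A * (M : Matrix (Fin n) (Fin n) ℂ)).trace).re)) s).toReal
          - ((gaussianReal 0 (1 / 2)) s).toReal|
        ≤ 4 / (n : ℝ) := by
  intro s hs
  set z := Complex.exp (-(θ : ℂ) * Complex.I) with hz
  have hzz : z * star z = 1 := by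
    rw [Complex.star_def, Complex.mul_conj, Complex.normSq_eq_norm_sq, hz]
    have : -(θ : ℂ) * Complex.I = ((-θ : ℝ) : ℂ) * Complex.I := by push_cast; ring
    rw [this, Complex.norm_exp_ofReal_mul_I]
    simp
  have hzA : ((z • A) * (z • A)ᴴ).trace = (n : ℂ) := by
    rw [conjTranspose_smul, smul_mul_smul_comm, hzz, one_smul, hA]
  have e : (fun M : Matrix.unitaryGroup (Fin n) ℂ =>
      (z * (A * (M : Matrix (Fin n) (Fin n) ℂ)).trace).re) =
      fun M : Matrix.unitaryGroup (Fin n) ℂ => ((M : Matrix (Fin n) (Fin n) ℂ) * (z • A)).trace.re := by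
    ext M
    rw [Matrix.trace_mul_comm A, mul_smul_comm, Matrix.trace_smul, smul_eq_mul]
  rw [e]
  have cM : Continuous fun M : Matrix.unitaryGroup (Fin n) ℂ =>
      ((M : Matrix (Fin n) (Fin n) ℂ) * (z • A)).trace.re :=
    (cont_retr (continuous_id.matrix_mul continuous_const)).comp continuous_subtype_val
  have : IsProbabilityMeasure (μ.map (fun M : Matrix.unitaryGroup (Fin n) ℂ =>
      ((M : Matrix (Fin n) (Fin n) ℂ) * (z • A)).trace.re)) :=
    Measure.isProbabilityMeasure_map cM.measurable.aemeasurable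
  refine tv_of_cont _ _ _ (fun h hc h0 h1 => ?_) s hs
  rw [integral_map cM.measurable.aemeasurable hc.aestronglyMeasurable]
  exact smooth_bound (by omega) μ (z • A) hzA h hc h0 h1
end

section
/- Let n ≥ 2, let A be a fixed n × n real diagonal matrix with diagonal entries a₁₁, …, aₙₙ satisfying Σᵢ aᵢᵢ² = n, and let M be a random matrix in the orthogonal group O(n) distributed according to Haar probability measure. Then E[(tr((AM)²))²] = 3(n+1)n²/((n−1)n(n+2)) − (3(n+1)/((n−1)n(n+2))) Σᵢ aᵢᵢ⁴ + (3/(n(n+2))) Σᵢ aᵢᵢ⁴. -/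
open MeasureTheory ProbabilityTheory Matrix

namespace HaarTrace

/-- The matrix reflecting in the coordinate plane of `i, k`. -/
noncomputable def refl {n : ℕ} (i k : Fin n) (c s : ℝ) : Matrix (Fin n) (Fin n) ℝ :=
  fun x y => if x = i then (if y = i then c else 0) + (if y = k then s else 0)
    else if x = k then (if y = i then s else 0) - (if y = k then c else 0)
    else if y = x then 1 else 0

lemma refl_mul {n : ℕ} (i k : Fin n) (c s : ℝ) (M : Matrix (Fin n) (Fin n) ℝ) (x j : Fin n) :
    (refl i k c s * M) x j = if x = i then c * M i j + s * M k j
      else if x = k then s * M i j - c * M k j else M x j := by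
  rw [Matrix.mul_apply]
  unfold refl
  split_ifs with h1 h2
  · simp [add_mul, Finset.sum_add_distrib]
  · simp [sub_mul, Finset.sum_sub_distrib]
  · simp

lemma refl_mem {n : ℕ} {i k : Fin n} (hik : i ≠ k) {c s : ℝ} (h : c ^ 2 + s ^ 2 = 1) :
    refl i k c s ∈ Matrix.orthogonalGroup (Fin n) ℝ := by
  rw [Matrix.mem_orthogonalGroup_iff]
  have : (refl i k c s)ᵀ = refl i k c s := by
    ext x y
    simp only [Matrix.transpose_apply, refl]
    grind
  rw [this]
  ext x y
  rw [refl_mul]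
  simp only [refl, Matrix.one_apply]
  grind

variable {n : ℕ} (μ : Measure (Matrix.orthogonalGroup (Fin n) ℝ))

/-- Entry of an orthogonal matrix. -/
def ent (M : Matrix.orthogonalGroup (Fin n) ℝ) (i j : Fin n) : ℝ :=
  (M : Matrix (Fin n) (Fin n) ℝ) i j

/-- Fourth mixed moment. -/
noncomputable def mom (i j k l p q r t : Fin n) : ℝ :=
  ∫ M, ent M i j * ent M k l * ent M p q * ent M r t ∂μ

lemma ent_cont (i j : Fin n) : Continuous fun M => ent M i j := by
  exact (continuous_apply j).comp ((continuous_apply i).comp continuous_subtype_val)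

lemma ent_bound (M : Matrix.orthogonalGroup (Fin n) ℝ) (i j : Fin n) : |ent M i j| ≤ 1 :=
  entry_norm_bound_of_unitary (𝕜 := ℝ) M.2 i j

lemma integ [IsFiniteMeasure μ] (i j k l p q r t : Fin n) :
    Integrable (fun M => ent M i j * ent M k l * ent M p q * ent M r t) μ := by
  refine Integrable.of_bound (C := 1) ?_ (Filter.Eventually.of_forall fun M => ?_)
  · have h := @ent_cont n
    exact ((((h i j).mul (h k l)).mul (h p q)).mul (h r t)).aestronglyMeasurable
  · simp only [norm_mul, Real.norm_eq_abs]
    have h := ent_bound M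
    have := mul_le_one₀ (h i j) (abs_nonneg _) (h k l)
    have := mul_le_one₀ this (abs_nonneg _) (h p q)
    exact mul_le_one₀ this (abs_nonneg _) (h r t)

lemma invar [μ.IsHaarMeasure] {i k : Fin n} (hik : i ≠ k) {c s : ℝ} (h : c ^ 2 + s ^ 2 = 1)
    (f : (Fin n → Fin n → ℝ) → ℝ) :
    ∫ M, f (ent M) ∂μ = ∫ M, f (fun x j => if x = i then c * ent M i j + s * ent M k j
      else if x = k then s * ent M i j - c * ent M k j else ent M x j) ∂μ := by
  rw [← integral_mul_left_eq_self (μ := μ) (fun M => f (ent M)) ⟨_, refl_mem hik h⟩]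
  congr 1
  ext M
  congr 1
  ext x j
  simp only [ent, Submonoid.coe_mul]
  exact refl_mul i k c s _ x j

lemma mom_swap [μ.IsHaarMeasure] (x y : Fin n) (i j k l p q r t : Fin n) :
    mom μ i j k l p q r t = mom μ (Equiv.swap x y i) j (Equiv.swap x y k) l
      (Equiv.swap x y p) q (Equiv.swap x y r) t := by
  by_cases hxy : x = y
  · subst hxy; simp
  unfold mom
  rw [invar μ hxy (c := 0) (s := 1) (by norm_num)
    (fun m => m i j * m k l * m p q * m r t)]
  have : ∀ (m : Fin n → Fin n → ℝ) (z w : Fin n), (if z = x then 0 * m x w + 1 * m y w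
      else if z = y then 1 * m x w - 0 * m y w else m z w) = m (Equiv.swap x y z) w := by
    intro m z w
    rw [Equiv.swap_apply_def]
    split_ifs <;> simp
  simp only [this]

lemma mom_sign [μ.IsHaarMeasure] {z y : Fin n} (hzy : z ≠ y) (i j k l p q r t : Fin n) :
    mom μ i j k l p q r t = (if i = y then -1 else 1) * (if k = y then -1 else 1) *
      (if p = y then -1 else 1) * (if r = y then -1 else 1) * mom μ i j k l p q r t := by
  conv_lhs => unfold mom
  rw [invar μ hzy (c := 1) (s := 0) (by norm_num)
    (fun m => m i j * m k l * m p q * m r t)]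
  unfold mom
  rw [← integral_const_mul]
  congr 1
  ext M
  have : ∀ (m : Fin n → Fin n → ℝ) (x w : Fin n), (if x = z then 1 * m z w + 0 * m y w
      else if x = y then 0 * m z w - 1 * m y w else m x w) = (if x = y then -1 else 1) * m x w := by
    intro m x w
    grind
  simp only [this]
  ring

/-- rotation identity: -/
lemma mom_rot [μ.IsHaarMeasure] [IsProbabilityMeasure μ] {i k : Fin n} (hik : i ≠ k) (j l : Fin n) :
    288 * mom μ i j i j i l i l = 144 * (mom μ i j i j k l k l + mom μ k j k j i l i l)
      + 576 * mom μ i j k j i l k l := by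
  have e : mom μ i j i j i l i l = (81 * mom μ i j i j i l i l + 256 * mom μ k j k j k l k l
      + 144 * (mom μ i j i j k l k l + mom μ k j k j i l i l) + 576 * mom μ i j k j i l k l
      + 216 * mom μ i j i j i l k l + 216 * mom μ i j k j i l i l
      + 384 * mom μ i j k j k l k l + 384 * mom μ k j k j i l k l) / 625 := by
    conv_lhs => unfold mom
    rw [invar μ hik (c := 3/5) (s := 4/5) (by norm_num)
      (fun m => m i j * m i j * m i l * m i l)]
    unfold mom
    simp only [← integral_const_mul, if_true]
    have I := integ μ
    rw [← integral_add (I ..) (I ..), ← integral_const_mul]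
    repeat rw [← integral_add]
    · rw [← integral_div]
      congr 1
      ext M
      ring
    all_goals
      repeat' apply Integrable.add
      all_goals
        first
        | exact (I ..).const_mul _
        | exact Integrable.const_mul (by apply Integrable.add <;> exact I ..) _
  have h1 := mom_sign μ hik i j i j i l k l
  have h2 := mom_sign μ hik i j k j i l i l
  have h3 := mom_sign μ hik i j k j k l k l
  have h4 := mom_sign μ hik k j k j i l k l
  have h5 := mom_swap μ i k i j i j i l i l
  simp only [hik, if_true, if_false, Equiv.swap_apply_left] at h1 h2 h3 h4 h5
  linarith

lemma col_norm (M : Matrix.orthogonalGroup (Fin n) ℝ) (j l : Fin n) :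
    ∑ i, ent M i j * ent M i l = if j = l then 1 else 0 := by
  have := (Matrix.mem_orthogonalGroup_iff' (Fin n) ℝ).1 M.2
  have := congrFun (congrFun this j) l
  simpa [Matrix.mul_apply, Matrix.one_apply, ent] using this

lemma sum_mom [IsProbabilityMeasure μ] (j l p q : Fin n) :
    ∑ i, ∑ k, mom μ i j i l k p k q = (if j = l then 1 else 0) * (if p = q then 1 else 0) := by
  unfold mom
  simp only [← integral_finsetSum Finset.univ (fun _ _ => integ μ ..)]
  rw [← integral_finsetSum]
  · trans ∫ M, (∑ i, ent M i j * ent M i l) * (∑ k, ent M k p * ent M k q) ∂μ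
    · congr 1
      ext M
      rw [Finset.sum_mul_sum]
      simp only [mul_assoc]
    · simp only [col_norm]
      simp
  · intro i _
    exact integrable_finsetSum _ fun _ _ => integ μ ..

lemma const_off [μ.IsHaarMeasure] {i k i' k' : Fin n} (h : i ≠ k) (h' : i' ≠ k') (j l p q : Fin n) :
    mom μ i j i l k p k q = mom μ i' j i' l k' p k' q := by
  have a1 := mom_swap μ i i' i j i l k p k q
  have a2 := mom_swap μ (Equiv.swap i i' k) k' i' j i' l (Equiv.swap i i' k) p (Equiv.swap i i' k) q
  rw [Equiv.swap_apply_left] at a1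
  rw [Equiv.swap_apply_left, Equiv.swap_apply_of_ne_of_ne (a := _) (x := i')] at a2
  · rw [a1, a2]
  · intro e
    have := Equiv.swap_apply_left i i'
    exact h ((Equiv.swap i i').injective (this.trans e))
  · exact h'

lemma const_diag [μ.IsHaarMeasure] (i i' : Fin n) (j l p q : Fin n) :
    mom μ i j i l i p i q = mom μ i' j i' l i' p i' q := by
  have a1 := mom_swap μ i i' i j i l i p i q
  rwa [Equiv.swap_apply_left] at a1

lemma sum_eval (g : Fin n → Fin n → ℝ) (d o : ℝ)
    (hd : ∀ i, g i i = d) (ho : ∀ i k, i ≠ k → g i k = o) :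
    ∑ i, ∑ k, g i k = n * (d + (n - 1) * o) := by
  have : ∀ i k, g i k = o + if i = k then d - o else 0 := by
    intro i k
    split_ifs with h
    · subst h; rw [hd]; ring
    · rw [ho i k h]; ring
  simp [this, Finset.sum_add_distrib]
  ring

lemma fourth [μ.IsHaarMeasure] [IsProbabilityMeasure μ] (hn : 2 ≤ n) (i j : Fin n) :
    mom μ i j i j i j i j = 3 / ((n : ℝ) * (n + 2)) := by
  have : Nontrivial (Fin n) := Fin.nontrivial_iff_two_le.2 hn
  obtain ⟨k, hk⟩ := exists_ne i
  have h := sum_mom μ j j j j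
  rw [sum_eval _ (mom μ i j i j i j i j) (mom μ i j i j k j k j)
    (fun x => const_diag μ x i ..) (fun x y hxy => const_off μ hxy hk.symm ..)] at h
  have r := mom_rot μ hk.symm j j
  have e1 := const_off μ hk hk.symm j j j j
  have e2 : mom μ i j k j i j k j = mom μ i j i j k j k j := by
    unfold mom; congr 1; ext M; ring
  have hn' : (2 : ℝ) ≤ n := by exact_mod_cast hn
  rw [eq_div_iff (by positivity)]
  simp only [if_true] at h
  have : mom μ i j i j k j k j = mom μ i j i j i j i j / 3 := by linarith
  rw [this] at h
  linarith

lemma offdiag [μ.IsHaarMeasure] [IsProbabilityMeasure μ] (hn : 2 ≤ n) {i j k l : Fin n}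
    (hk : i ≠ k) (hj : j ≠ l) :
    mom μ i j i j k l k l = (n + 1) / (((n : ℝ) - 1) * n * (n + 2)) := by
  have h := sum_mom μ j j l l
  have h' := sum_mom μ j l j l
  rw [sum_eval _ (mom μ i j i j i l i l) (mom μ i j i j k l k l)
    (fun x => const_diag μ x i ..) (fun x y hxy => const_off μ hxy hk ..)] at h
  rw [sum_eval _ (mom μ i j i l i j i l) (mom μ i j i l k j k l)
    (fun x => const_diag μ x i ..) (fun x y hxy => const_off μ hxy hk ..)] at h'
  have r := mom_rot μ hk j l
  have e1 := const_off μ hk.symm hk j j l l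
  have e2 : mom μ i j i l k j k l = mom μ i j k j i l k l := by
    unfold mom; congr 1; ext M; ring
  have e3 : mom μ i j i l i j i l = mom μ i j i j i l i l := by
    unfold mom; congr 1; ext M; ring
  have hn' : (2 : ℝ) ≤ n := by exact_mod_cast hn
  have : (0 : ℝ) < n - 1 := by linarith
  rw [eq_div_iff (by positivity)]
  rw [e2, e3] at h'
  simp only [if_true, hj, if_false] at h h'
  have h3 := (mul_eq_zero.1 (h'.trans (mul_zero _))).resolve_left (by positivity)
  set S := mom μ i j i j i l i l
  set T := mom μ i j i j k l k l
  set W := mom μ i j k j i l k l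
  have hS : S = -(n - 1) * W := by linarith
  have hT : T = -(n + 1) * W := by linarith
  rw [hS, hT] at h
  rw [hT]
  linear_combination (n + 1 : ℝ) * h

lemma moment_formula [μ.IsHaarMeasure] [IsProbabilityMeasure μ] (hn : 2 ≤ n) (i j k l : Fin n) :
    mom μ i j j i k l l k = (n + 1) / (((n : ℝ) - 1) * n * (n + 2)) *
      ((if i = j then if k = l then 1 else 0 else 0) + (if i = k then if j = l then 1 else 0 else 0)
        + (if i = l then if j = k then 1 else 0 else 0))
      + (3 / ((n : ℝ) * (n + 2)) - 3 * ((n + 1) / (((n : ℝ) - 1) * n * (n + 2)))) *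
        (if i = j then if i = k then if i = l then 1 else 0 else 0 else 0) := by
  have : Nontrivial (Fin n) := Fin.nontrivial_iff_two_le.2 hn
  have sgn : ∀ y : Fin n, _ := fun y =>
    mom_sign μ (exists_ne y).choose_spec i j j i k l l k
  by_cases hij : i = j
  · subst hij
    by_cases hkl : k = l
    · subst hkl
      by_cases hik : i = k
      · subst hik
        rw [fourth μ hn]
        simp
        ring
      · rw [offdiag μ hn hik hik]
        simp [hik]
    · have s1 := sgn k
      have s2 := sgn l
      clear sgn
      generalize ((n : ℝ) + 1) / (((n : ℝ) - 1) * n * (n + 2)) = T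
      generalize 3 / ((n : ℝ) * (n + 2)) = P
      grind
  · by_cases hik : i = k
    · subst hik
      by_cases hjl : j = l
      · subst hjl
        have e : mom μ i j j i i j j i = mom μ i j i j j i j i := by
          unfold mom; congr 1; ext M; ring
        rw [e, offdiag μ hn hij (Ne.symm hij)]
        simp [hij]
      · have s1 := sgn j
        have s2 := sgn l
        clear sgn
        generalize ((n : ℝ) + 1) / (((n : ℝ) - 1) * n * (n + 2)) = T
        generalize 3 / ((n : ℝ) * (n + 2)) = P
        grind
    · by_cases hil : i = l
      · subst hil
        by_cases hjk : j = k
        · subst hjk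
          have e : mom μ i j j i j i i j = mom μ i j i j j i j i := by
            unfold mom; congr 1; ext M; ring
          rw [e, offdiag μ hn hij (Ne.symm hij)]
          simp [hij]
        · have s1 := sgn j
          clear sgn
          generalize ((n : ℝ) + 1) / (((n : ℝ) - 1) * n * (n + 2)) = T
          generalize 3 / ((n : ℝ) * (n + 2)) = P
          grind
      · have s1 := sgn i
        clear sgn
        generalize ((n : ℝ) + 1) / (((n : ℝ) - 1) * n * (n + 2)) = T
        generalize 3 / ((n : ℝ) * (n + 2)) = P
        grind

end HaarTrace

/-- For `A` real diagonal with `Σᵢ aᵢᵢ² = n` and `M` Haar-distributed on `O(n)`,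
`E[(tr((AM)²))²] = 3(n+1)n²/((n-1)n(n+2)) - (3(n+1)/((n-1)n(n+2))) Σᵢ aᵢᵢ⁴
  + (3/(n(n+2))) Σᵢ aᵢᵢ⁴`. -/
theorem haar_orthogonal_trace_sq_second_moment (n : ℕ) (hn : 2 ≤ n)
    (a : Fin n → ℝ) (ha : ∑ i, (a i) ^ 2 = (n : ℝ))
    (μ : Measure (Matrix.orthogonalGroup (Fin n) ℝ))
    [μ.IsHaarMeasure] [IsProbabilityMeasure μ] :
    ∫ M : Matrix.orthogonalGroup (Fin n) ℝ,
        (((Matrix.diagonal a * (M : Matrix (Fin n) (Fin n) ℝ)) *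
          (Matrix.diagonal a * (M : Matrix (Fin n) (Fin n) ℝ))).trace) ^ 2 ∂μ
      = 3 * ((n : ℝ) + 1) * (n : ℝ) ^ 2 / (((n : ℝ) - 1) * (n : ℝ) * ((n : ℝ) + 2))
        - (3 * ((n : ℝ) + 1) / (((n : ℝ) - 1) * (n : ℝ) * ((n : ℝ) + 2))) * ∑ i, (a i) ^ 4
        + (3 / ((n : ℝ) * ((n : ℝ) + 2))) * ∑ i, (a i) ^ 4 := by
  have key : ∀ M : Matrix.orthogonalGroup (Fin n) ℝ,
      (((Matrix.diagonal a * (M : Matrix (Fin n) (Fin n) ℝ)) *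
          (Matrix.diagonal a * (M : Matrix (Fin n) (Fin n) ℝ))).trace) ^ 2 =
      ∑ i, ∑ j, ∑ k, ∑ l, (a i * a j * a k * a l) * (HaarTrace.ent M i j * HaarTrace.ent M j i *
        HaarTrace.ent M k l * HaarTrace.ent M l k) := by
    intro M
    have : ((Matrix.diagonal a * (M : Matrix (Fin n) (Fin n) ℝ)) *
          (Matrix.diagonal a * (M : Matrix (Fin n) (Fin n) ℝ))).trace =
        ∑ i, ∑ j, a i * a j * (HaarTrace.ent M i j * HaarTrace.ent M j i) := by
      simp only [Matrix.trace, Matrix.diag, Matrix.mul_apply (M := Matrix.diagonal a * _),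
        Matrix.diagonal_mul, HaarTrace.ent]
      refine Finset.sum_congr rfl fun i _ => Finset.sum_congr rfl fun j _ => ?_
      ring
    rw [this, sq]
    simp only [Finset.sum_mul, Finset.mul_sum]
    refine Finset.sum_congr rfl fun i _ => Finset.sum_congr rfl fun j _ =>
      Finset.sum_congr rfl fun k _ => Finset.sum_congr rfl fun l _ => ?_
    ring
  simp only [key]
  have I := fun i j k l => (HaarTrace.integ μ i j j i k l l k).const_mul (a i * a j * a k * a l)
  have I1 := fun i j k => integrable_finsetSum Finset.univ (fun l _ => I i j k l)
  have I2 := fun i j => integrable_finsetSum Finset.univ (fun k _ => I1 i j k)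
  have I3 := fun i => integrable_finsetSum Finset.univ (fun j _ => I2 i j)
  rw [integral_finsetSum _ (fun i _ => I3 i)]
  simp only [integral_finsetSum _ (fun j _ => I2 _ j)]
  simp only [integral_finsetSum _ (fun k _ => I1 _ _ k)]
  simp only [integral_finsetSum _ (fun l _ => I _ _ _ l), integral_const_mul]
  have m := HaarTrace.moment_formula μ hn
  unfold HaarTrace.mom at m
  simp only [m]
  generalize hT : ((n : ℝ) + 1) / (((n : ℝ) - 1) * n * (n + 2)) = T
  generalize 3 / ((n : ℝ) * (n + 2)) = P
  have e1 : 3 * ((n : ℝ) + 1) * (n : ℝ) ^ 2 / (((n : ℝ) - 1) * (n : ℝ) * ((n : ℝ) + 2))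
      = 3 * T * ((∑ i, (a i) ^ 2) * ∑ i, (a i) ^ 2) := by rw [ha, ← hT]; ring
  have e2 : 3 * ((n : ℝ) + 1) / (((n : ℝ) - 1) * (n : ℝ) * ((n : ℝ) + 2)) = 3 * T := by
    rw [← hT]; ring
  rw [e1, e2, Finset.sum_mul_sum]
  have split : ∀ i j k l : Fin n, (a i * a j * a k * a l) * (T *
      ((if i = j then if k = l then 1 else 0 else 0) + (if i = k then if j = l then 1 else 0 else 0)
        + (if i = l then if j = k then 1 else 0 else 0))
      + (P - 3 * T) * (if i = j then if i = k then if i = l then 1 else 0 else 0 else 0)) =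
      (if i = j then if k = l then T * (a i ^ 2 * a k ^ 2) else 0 else 0)
      + (if i = k then if j = l then T * (a i ^ 2 * a j ^ 2) else 0 else 0)
      + (if i = l then if j = k then T * (a i ^ 2 * a j ^ 2) else 0 else 0)
      + (if i = j then if i = k then if i = l then (P - 3 * T) * a i ^ 4 else 0 else 0 else 0) := by
    intro i j k l
    have f1 : T * (a i * a j * a k * a l) * (if i = j then if k = l then 1 else 0 else 0) =
      (if i = j then if k = l then T * (a i ^ 2 * a k ^ 2) else 0 else 0) := by
      split_ifs with h1 h2
      · subst h1 h2; ring
      all_goals simp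
    have f2 : T * (a i * a j * a k * a l) * (if i = k then if j = l then 1 else 0 else 0) =
      (if i = k then if j = l then T * (a i ^ 2 * a j ^ 2) else 0 else 0) := by
      split_ifs with h1 h2
      · subst h1 h2; ring
      all_goals simp
    have f3 : T * (a i * a j * a k * a l) * (if i = l then if j = k then 1 else 0 else 0) =
      (if i = l then if j = k then T * (a i ^ 2 * a j ^ 2) else 0 else 0) := by
      split_ifs with h1 h2
      · subst h1 h2; ring
      all_goals simp
    have f4 : (P - 3 * T) * (a i * a j * a k * a l) *
        (if i = j then if i = k then if i = l then 1 else 0 else 0 else 0) =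
      (if i = j then if i = k then if i = l then (P - 3 * T) * a i ^ 4 else 0 else 0 else 0) := by
      split_ifs with h1 h2 h3
      · rw [← h1, ← h2, ← h3]; ring
      all_goals simp
    linear_combination f1 + f2 + f3 + f4
  simp only [split, Finset.sum_add_distrib]
  have g1 : ∑ i : Fin n, ∑ j : Fin n, ∑ k : Fin n, ∑ l : Fin n,
      (if i = j then if k = l then T * (a i ^ 2 * a k ^ 2) else 0 else 0) =
      T * ∑ i, ∑ k, a i ^ 2 * a k ^ 2 := by
    simp only [Finset.mul_sum]
    refine Finset.sum_congr rfl fun i _ => ?_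
    rw [Finset.sum_eq_single i (by intro b _ hb; simp [hb.symm]) (by simp)]
    simp
  have g2 : ∑ i : Fin n, ∑ j : Fin n, ∑ k : Fin n, ∑ l : Fin n,
      (if i = k then if j = l then T * (a i ^ 2 * a j ^ 2) else 0 else 0) =
      T * ∑ i, ∑ k, a i ^ 2 * a k ^ 2 := by
    simp only [Finset.mul_sum]
    refine Finset.sum_congr rfl fun i _ => Finset.sum_congr rfl fun j _ => ?_
    rw [Finset.sum_eq_single i (by intro b _ hb; simp [hb.symm]) (by simp)]
    simp
  have g3 : ∑ i : Fin n, ∑ j : Fin n, ∑ k : Fin n, ∑ l : Fin n,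
      (if i = l then if j = k then T * (a i ^ 2 * a j ^ 2) else 0 else 0) =
      T * ∑ i, ∑ k, a i ^ 2 * a k ^ 2 := by
    simp only [Finset.mul_sum]
    refine Finset.sum_congr rfl fun i _ => Finset.sum_congr rfl fun j _ => ?_
    simp
  have g4 : ∑ i : Fin n, ∑ j : Fin n, ∑ k : Fin n, ∑ l : Fin n,
      (if i = j then if i = k then if i = l then (P - 3 * T) * a i ^ 4 else 0 else 0 else 0) =
      (P - 3 * T) * ∑ i, a i ^ 4 := by
    simp only [Finset.mul_sum]
    refine Finset.sum_congr rfl fun i _ => ?_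
    rw [Finset.sum_eq_single i (by intro b _ hb; simp [hb.symm]) (by simp)]
    rw [Finset.sum_eq_single i (by intro b _ hb; simp [hb.symm]) (by simp)]
    simp
  rw [g1, g2, g3, g4]
  ring
end

section
/- Let n ≥ 2, let A be a fixed n × n real diagonal matrix with diagonal entries a₁₁, …, aₙₙ satisfying Σᵢ aᵢᵢ² = n, and let M be a random matrix in the orthogonal group O(n) distributed according to Haar probability measure. Then E[(tr((AM)²))²] ≤ 3 + 6/((n−1)(n+2)). -/
open MeasureTheory ProbabilityTheory Matrix

/-- Entry of an orthogonal matrix. -/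
def ent {n : ℕ} (M : Matrix.orthogonalGroup (Fin n) ℝ) (i j : Fin n) : ℝ :=
  (M : Matrix (Fin n) (Fin n) ℝ) i j

def wv {n : ℕ} (r s : Fin n) (α β : ℝ) : Fin n → ℝ := Pi.single r α + Pi.single s β

/-- Householder matrix. -/
noncomputable def hh {n : ℕ} (r s : Fin n) (α β : ℝ) : Matrix (Fin n) (Fin n) ℝ :=
  1 - (2 / (α ^ 2 + β ^ 2)) • Matrix.vecMulVec (wv r s α β) (wv r s α β)

lemma wv_dot {n : ℕ} (r s : Fin n) (α β : ℝ) (x : Fin n → ℝ) :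
    wv r s α β ⬝ᵥ x = α * x r + β * x s := by
  simp [wv, add_dotProduct]

lemma hh_mem {n : ℕ} (r s : Fin n) (hrs : r ≠ s) (α β : ℝ) (h : α ^ 2 + β ^ 2 ≠ 0) :
    hh r s α β ∈ Matrix.orthogonalGroup (Fin n) ℝ := by
  rw [Matrix.mem_orthogonalGroup_iff]
  have h1 : (hh r s α β).transpose = hh r s α β := by
    ext i j
    simp [hh, Matrix.vecMulVec_apply, Matrix.one_apply, eq_comm,
      mul_comm]
  rw [h1]
  have h2 : Matrix.vecMulVec (wv r s α β) (wv r s α β) * Matrix.vecMulVec (wv r s α β) (wv r s α β)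
      = (α ^ 2 + β ^ 2) • Matrix.vecMulVec (wv r s α β) (wv r s α β) := by
    rw [Matrix.vecMulVec_mul_vecMulVec, wv_dot]
    have : α * wv r s α β r + β * wv r s α β s = α ^ 2 + β ^ 2 := by
      simp [wv, hrs, hrs.symm]; ring
    rw [this]
    ext i j
    simp [Matrix.vecMulVec_apply]
    ring
  simp only [hh, sub_mul, mul_sub, one_mul, mul_one, smul_mul_assoc, mul_smul_comm, h2, smul_smul,
    smul_sub]
  rw [show 2 / (α ^ 2 + β ^ 2) * (2 / (α ^ 2 + β ^ 2) * (α ^ 2 + β ^ 2))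
    = 2 / (α ^ 2 + β ^ 2) + 2 / (α ^ 2 + β ^ 2) by field_simp; norm_num, add_smul]
  abel

noncomputable def hg {n : ℕ} (r s : Fin n) (hrs : r ≠ s) (α β : ℝ) (h : α ^ 2 + β ^ 2 ≠ 0) :
    Matrix.orthogonalGroup (Fin n) ℝ := ⟨hh r s α β, hh_mem r s hrs α β h⟩

lemma ent_hg {n : ℕ} (r s : Fin n) (hrs : r ≠ s) (α β : ℝ) (h : α ^ 2 + β ^ 2 ≠ 0)
    (M : Matrix.orthogonalGroup (Fin n) ℝ) (i c : Fin n) :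
    ent (hg r s hrs α β h * M) i c =
      ent M i c - 2 / (α ^ 2 + β ^ 2) * wv r s α β i * (α * ent M r c + β * ent M s c) := by
  have := wv_dot r s α β (fun i => ent M i c)
  rw [← this]
  simp only [ent, hg, hh]
  rw [Submonoid.coe_mul]
  simp only [sub_mul, one_mul, Matrix.sub_apply]
  simp [Matrix.mul_apply, Matrix.vecMulVec_apply, dotProduct, Finset.mul_sum, mul_assoc]

lemma ent_cont {n : ℕ} (i j : Fin n) :
    Continuous (fun M : Matrix.orthogonalGroup (Fin n) ℝ => ent M i j) := by
  unfold ent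
  exact (continuous_subtype_val).matrix_elem i j

lemma ent_bound {n : ℕ} (M : Matrix.orthogonalGroup (Fin n) ℝ) (i j : Fin n) :
    |ent M i j| ≤ 1 := entry_norm_bound_of_unitary M.2 i j

lemma col_orth {n : ℕ} (M : Matrix.orthogonalGroup (Fin n) ℝ) (c d : Fin n) :
    ∑ s, ent M s c * ent M s d = if c = d then 1 else 0 := by
  have := (Matrix.mem_orthogonalGroup_iff' _ _).1 M.2
  have := congrFun (congrFun this c) d
  simpa [ent, Matrix.mul_apply, Matrix.one_apply] using this

section
variable {n : ℕ} (μ : Measure (Matrix.orthogonalGroup (Fin n) ℝ)) [μ.IsHaarMeasure]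

lemma int_inv (g : Matrix.orthogonalGroup (Fin n) ℝ) (f : Matrix.orthogonalGroup (Fin n) ℝ → ℝ) :
    ∫ M, f (g * M) ∂μ = ∫ M, f M ∂μ := integral_mul_left_eq_self f g

/-- fourth moments -/
noncomputable def E4 (i i' j j' k k' l l' : Fin n) : ℝ :=
  ∫ M, ent M i i' * ent M j j' * ent M k k' * ent M l l' ∂μ

lemma E4_sign (i i' j j' k k' l l' : Fin n) (hj : i ≠ j) (hk : i ≠ k) (hl : i ≠ l) :
    E4 μ i i' j j' k k' l l' = 0 := by
  have h := int_inv μ (hg i j hj 1 0 (by norm_num))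
    (fun M => ent M i i' * ent M j j' * ent M k k' * ent M l l')
  simp only [ent_hg] at h
  have e : ∀ x, i ≠ x → wv i j 1 0 x = 0 := by
    intro x hx; simp [wv, hx.symm]
  have e0 : wv i j 1 0 i = 1 := by simp [wv]
  rw [e j hj, e k hk, e l hl, e0] at h
  have : E4 μ i i' j j' k k' l l' = - E4 μ i i' j j' k k' l l' := by
    conv_lhs => unfold E4
    rw [← h, E4, ← integral_neg]
    congr 1; ext M; ring
  linarith

/-- swapping rows r and s -/
lemma int_swap (r s : Fin n) (hrs : r ≠ s) (f : (Fin n → Fin n → ℝ) → ℝ) :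
    ∫ M, f (fun i c => ent M (Equiv.swap r s i) c) ∂μ = ∫ M, f (ent M) ∂μ := by
  rw [← int_inv μ (hg r s hrs 1 (-1) (by norm_num)) (fun M => f (ent M))]
  congr 1; ext M; congr 1; ext i c
  rw [ent_hg]
  by_cases h1 : i = r
  · subst h1; simp [wv, hrs]; norm_num
  by_cases h2 : i = s
  · subst h2; simp [wv, hrs.symm]; norm_num
  · simp [wv, h1, h2, Equiv.swap_apply_of_ne_of_ne h1 h2]

variable [IsProbabilityMeasure μ]

lemma int4 (i j k l i' j' k' l' : Fin n) :
    Integrable (fun M => ent M i i' * ent M j j' * ent M k k' * ent M l l') μ := by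
  apply Integrable.of_bound (C := 1)
  · exact ((((ent_cont i i').mul (ent_cont j j')).mul (ent_cont k k')).mul
      (ent_cont l l')).aestronglyMeasurable
  · refine Filter.Eventually.of_forall fun M => ?_
    simp only [norm_mul, Real.norm_eq_abs]
    have := ent_bound M
    exact mul_le_one₀ (mul_le_one₀ (mul_le_one₀ (this _ _) (abs_nonneg _) (this _ _))
      (abs_nonneg _) (this _ _)) (abs_nonneg _) (this _ _)

lemma int2 (i j i' j' : Fin n) :
    Integrable (fun M => ent M i i' * ent M j j') μ := by
  apply Integrable.of_bound (C := 1)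
  · exact ((ent_cont i i').mul (ent_cont j j')).aestronglyMeasurable
  · refine Filter.Eventually.of_forall fun M => ?_
    simp only [norm_mul, Real.norm_eq_abs]
    have := ent_bound M
    exact (mul_le_one₀ (this _ _) (abs_nonneg _) (this _ _))

lemma second (hn : 2 ≤ n) (r c : Fin n) : ∫ M, ent M r c * ent M r c ∂μ = 1 / n := by
  have h : ∀ s, ∫ M, ent M s c * ent M s c ∂μ = ∫ M, ent M r c * ent M r c ∂μ := by
    intro s
    by_cases hs : r = s
    · rw [hs]
    · have := int_swap μ r s hs (fun f => f r c * f r c)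
      simpa using this
  have h2 : ∑ s, ∫ M, ent M s c * ent M s c ∂μ = 1 := by
    rw [← integral_finsetSum _ (fun s _ => int2 μ s s c c)]
    simp [col_orth]
  simp only [h, Finset.sum_const, Finset.card_univ, Fintype.card_fin, nsmul_eq_mul] at h2
  have : (n : ℝ) ≠ 0 := by positivity
  rw [eq_div_iff this]; linarith

lemma rot (r s : Fin n) (hrs : r ≠ s) (c d : Fin n) :
    E4 μ r c r c r d r d = E4 μ r c r c s d s d + 2 * E4 μ r c s c r d s d := by
  have hT : E4 μ s c s c s d s d = E4 μ r c r c r d r d := by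
    simpa [E4] using int_swap μ r s hrs (fun f => f r c * f r c * f r d * f r d)
  have hq : E4 μ s c s c r d r d = E4 μ r c r c s d s d := by
    simpa [E4] using int_swap μ r s hrs (fun f => f r c * f r c * f s d * f s d)
  have h1 := int_inv μ (hg r s hrs 1 (-2) (by norm_num))
    (fun M => ent M r c * ent M r c * ent M r d * ent M r d)
  have h2 := int_inv μ (hg r s hrs 1 2 (by norm_num))
    (fun M => ent M r c * ent M r c * ent M r d * ent M r d)
  have i1 := int4 μ
  have key : ∫ M, ((1/625) * (162 * (ent M r c * ent M r c * ent M r d * ent M r d)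
      + 288 * (ent M r c * ent M r c * ent M s d * ent M s d)
      + 288 * (ent M s c * ent M s c * ent M r d * ent M r d)
      + 512 * (ent M s c * ent M s c * ent M s d * ent M s d)
      + 1152 * (ent M r c * ent M s c * ent M r d * ent M s d))) ∂μ
      = 2 * E4 μ r c r c r d r d := by
    rw [two_mul]
    conv_rhs => unfold E4
    conv_rhs => congr; rw [← h1]; rfl; rw [← h2]
    have j : ∀ g : Matrix.orthogonalGroup (Fin n) ℝ, Integrable (fun M => ent (g * M) r c * ent (g * M) r c * ent (g * M) r d * ent (g * M) r d) μ :=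
      fun g => (i1 r r r r c c d d).comp_mul_left g
    rw [← integral_add (j _) (j _)]
    congr 1; ext M
    simp only [ent_hg]
    have w1 : ∀ β, wv r s 1 β r = 1 := by intro β; simp [wv, hrs]
    simp only [w1]
    ring
  rw [integral_const_mul, integral_add (by fun_prop) (by fun_prop),
    integral_add (by fun_prop) (by fun_prop), integral_add (by fun_prop) (by fun_prop),
    integral_add (by fun_prop) (by fun_prop)] at key
  simp only [integral_const_mul] at key
  simp only [E4] at *
  linarith

lemma sum_q (hn : 2 ≤ n) (r c d : Fin n) : ∑ s, E4 μ r c r c s d s d = 1 / n := by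
  simp only [E4]
  rw [← integral_finsetSum _ (fun s _ => int4 μ _ _ _ _ _ _ _ _), ← second μ hn r c]
  congr 1; ext M
  have := col_orth M d d
  simp only [mul_assoc, ← Finset.mul_sum, this]
  simp

lemma sum_u (hn : 2 ≤ n) (r c d : Fin n) :
    ∑ s, E4 μ r c s c r d s d = if c = d then (1 / n : ℝ) else 0 := by
  simp only [E4]
  rw [← integral_finsetSum _ (fun s _ => int4 μ _ _ _ _ _ _ _ _)]
  have : ∀ M : Matrix.orthogonalGroup (Fin n) ℝ,
      ∑ s, ent M r c * ent M s c * ent M r d * ent M s d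
        = if c = d then ent M r c * ent M r c else 0 := by
    intro M
    have h := col_orth M c d
    have h2 : ∑ s, ent M r c * ent M s c * ent M r d * ent M s d
        = (ent M r c * ent M r d) * ∑ s, ent M s c * ent M s d := by
      rw [Finset.mul_sum]; exact Finset.sum_congr rfl fun s _ => by ring
    rw [h2, h]
    split_ifs with hc
    · subst hc; ring
    · ring
  simp only [this]
  split_ifs with hc
  · exact second μ hn r c
  · simp

lemma T_val (hn : 2 ≤ n) (r c d : Fin n) :
    ((n : ℝ) + 2) * E4 μ r c r c r d r d = 1 / n + 2 * (if c = d then (1 / n : ℝ) else 0) := by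
  rw [← sum_u μ hn r c d, ← sum_q μ hn r c d, Finset.mul_sum, ← Finset.sum_add_distrib]
  have : ∀ s, E4 μ r c r c s d s d + 2 * E4 μ r c s c r d s d
      = E4 μ r c r c r d r d + if s = r then 2 * E4 μ r c r c r d r d else 0 := by
    intro s
    split_ifs with h
    · subst h; rfl
    · rw [rot μ r s (Ne.symm h)]; ring
  simp only [this, Finset.sum_add_distrib]
  simp
  ring

lemma q_val (hn : 2 ≤ n) (r s c d : Fin n) (hrs : r ≠ s) :
    ((n : ℝ) - 1) * E4 μ r c r c s d s d = 1 / n - E4 μ r c r c r d r d := by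
  rw [← sum_q μ hn r c d]
  have : ∀ t, E4 μ r c r c t d t d = E4 μ r c r c s d s d
      + if t = r then E4 μ r c r c r d r d - E4 μ r c r c s d s d else 0 := by
    intro t
    split_ifs with h
    · subst h; ring
    · rw [add_zero]
      by_cases hts : s = t
      · rw [hts]
      · have := int_swap μ s t hts (fun f => f r c * f r c * f s d * f s d)
        beta_reduce at this
        rw [Equiv.swap_apply_of_ne_of_ne hrs (Ne.symm h)] at this
        simpa [E4] using this
  rw [Finset.sum_congr rfl (fun t _ => this t), Finset.sum_add_distrib]
  simp
  ring

lemma q_eq (hn : 2 ≤ n) (r s c d : Fin n) (hrs : r ≠ s) (hcd : c ≠ d) :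
    E4 μ r c r c s d s d = ((n : ℝ) + 1) / (n * (n - 1) * (n + 2)) := by
  have h1 := q_val μ hn r s c d hrs
  have h2 := T_val μ hn r c d
  rw [if_neg hcd] at h2
  have hn' : (2 : ℝ) ≤ n := by exact_mod_cast hn
  have a1 : (n : ℝ) ≠ 0 := by positivity
  have a2 : (n : ℝ) - 1 ≠ 0 := by linarith
  have a3 : (n : ℝ) + 2 ≠ 0 := by positivity
  have h3 : E4 μ r c r c r d r d = 1 / (n * (n + 2)) := by
    field_simp at h2 ⊢; linarith
  rw [h3] at h1
  field_simp at h1 ⊢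
  linarith

lemma p_le (hn : 2 ≤ n) (r c : Fin n) :
    E4 μ r c r c r c r c ≤ 3 * (((n : ℝ) + 1) / (n * (n - 1) * (n + 2))) := by
  have h2 := T_val μ hn r c c
  rw [if_pos rfl] at h2
  have hn' : (2 : ℝ) ≤ n := by exact_mod_cast hn
  have a1 : 0 < (n : ℝ) := by positivity
  have a2 : 0 < (n : ℝ) - 1 := by linarith
  have a3 : 0 < (n : ℝ) + 2 := by positivity
  have h3 : E4 μ r c r c r c r c = 3 / (n * (n + 2)) := by
    field_simp at h2 ⊢; linarith
  rw [h3, mul_div_assoc', div_le_div_iff₀ (by positivity) (by positivity)]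
  have : 0 ≤ 6 * ((n : ℝ) * (n + 2)) := by positivity
  nlinarith

lemma term_le (hn : 2 ≤ n) (a : Fin n → ℝ) (i j k l : Fin n) :
    a i * a j * a k * a l * E4 μ i j j i k l l k ≤
      ((n : ℝ) + 1) / (n * (n - 1) * (n + 2)) *
      ((if j = i then (if l = k then a i ^ 2 * a k ^ 2 else 0) else 0)
      + (if k = i then (if l = j then a i ^ 2 * a j ^ 2 else 0) else 0)
      + (if l = i then (if k = j then a i ^ 2 * a j ^ 2 else 0) else 0)) := by
  by_cases h1 : j = i ∧ l = k
  · obtain ⟨rfl, rfl⟩ := h1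
    by_cases h : l = j
    · subst h
      have := mul_le_mul_of_nonneg_left (p_le μ hn l l) (by positivity : 0 ≤ a l ^ 4)
      simp only [if_true]
      linarith
    · rw [q_eq μ hn j l j l (Ne.symm h) (Ne.symm h)]
      simp [h]
      apply le_of_eq; ring
  by_cases h2 : k = i ∧ l = j
  · obtain ⟨rfl, rfl⟩ := h2
    have h : l ≠ k := fun h => h1 ⟨h, h⟩
    have e : E4 μ k l l k k l l k = E4 μ k l k l l k l k := by
      unfold E4; congr 1; ext M; ring
    rw [e, q_eq μ hn k l l k h.symm h]
    simp [h]
    apply le_of_eq; ring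
  by_cases h3 : l = i ∧ k = j
  · obtain ⟨rfl, rfl⟩ := h3
    have h : k ≠ l := fun h => h1 ⟨h, h.symm⟩
    have e : E4 μ l k k l k l l k = E4 μ l k l k k l k l := by
      unfold E4; congr 1; ext M; ring
    rw [e, q_eq μ hn l k k l h.symm h]
    simp [h]
    apply le_of_eq; ring
  have z : E4 μ i j j i k l l k = 0 := by
    by_cases c1 : i ≠ j ∧ i ≠ k ∧ i ≠ l
    · exact E4_sign μ _ _ _ _ _ _ _ _ c1.1 c1.2.1 c1.2.2
    by_cases c2 : j ≠ i ∧ j ≠ k ∧ j ≠ l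
    · rw [← E4_sign μ j i i j k l l k c2.1 c2.2.1 c2.2.2]
      unfold E4; congr 1; ext M; ring
    by_cases c3 : k ≠ i ∧ k ≠ j ∧ k ≠ l
    · rw [← E4_sign μ k l i j j i l k c3.1 c3.2.1 c3.2.2]
      unfold E4; congr 1; ext M; ring
    by_cases c4 : l ≠ i ∧ l ≠ j ∧ l ≠ k
    · rw [← E4_sign μ l k i j j i k l c4.1 c4.2.1 c4.2.2]
      unfold E4; congr 1; ext M; ring
    exfalso
    grind
  have e1 : (if j = i then (if l = k then a i ^ 2 * a k ^ 2 else 0) else 0) = 0 := by grind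
  have e2 : (if k = i then (if l = j then a i ^ 2 * a j ^ 2 else 0) else 0) = 0 := by grind
  have e3 : (if l = i then (if k = j then a i ^ 2 * a j ^ 2 else 0) else 0) = 0 := by grind
  rw [z, e1, e2, e3]; simp

end

/-- For `A` real diagonal with `Σᵢ aᵢᵢ² = n` and `M` Haar-distributed on `O(n)`,
`E[(tr((AM)²))²] ≤ 3 + 6/((n-1)(n+2))`. -/
theorem haar_orthogonal_trace_sq_second_moment_bound (n : ℕ) (hn : 2 ≤ n)
    (a : Fin n → ℝ) (ha : ∑ i, (a i) ^ 2 = (n : ℝ))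
    (μ : Measure (Matrix.orthogonalGroup (Fin n) ℝ))
    [μ.IsHaarMeasure] [IsProbabilityMeasure μ] :
    ∫ M : Matrix.orthogonalGroup (Fin n) ℝ,
        (((Matrix.diagonal a * (M : Matrix (Fin n) (Fin n) ℝ)) *
          (Matrix.diagonal a * (M : Matrix (Fin n) (Fin n) ℝ))).trace) ^ 2 ∂μ
      ≤ 3 + 6 / (((n : ℝ) - 1) * ((n : ℝ) + 2)) := by
  have hint : ∫ M : Matrix.orthogonalGroup (Fin n) ℝ,
        (((Matrix.diagonal a * (M : Matrix (Fin n) (Fin n) ℝ)) *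
          (Matrix.diagonal a * (M : Matrix (Fin n) (Fin n) ℝ))).trace) ^ 2 ∂μ
      = ∑ i, ∑ j, ∑ k, ∑ l, a i * a j * a k * a l * E4 μ i j j i k l l k := by
    have i4 : ∀ i j k l : Fin n, Integrable (fun M => a i * a j * a k * a l *
        (ent M i j * ent M j i * ent M k l * ent M l k)) μ :=
      fun i j k l => (int4 μ i j k l j i l k).const_mul _
    have hp : ∀ M : Matrix.orthogonalGroup (Fin n) ℝ,
        (((Matrix.diagonal a * (M : Matrix (Fin n) (Fin n) ℝ)) *
          (Matrix.diagonal a * (M : Matrix (Fin n) (Fin n) ℝ))).trace) ^ 2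
        = ∑ i, ∑ j, ∑ k, ∑ l, a i * a j * a k * a l *
          (ent M i j * ent M j i * ent M k l * ent M l k) := by
      intro M
      have : ((Matrix.diagonal a * (M : Matrix (Fin n) (Fin n) ℝ)) *
          (Matrix.diagonal a * (M : Matrix (Fin n) (Fin n) ℝ))).trace
          = ∑ i, ∑ j, (a i * ent M i j) * (a j * ent M j i) := by
        simp only [Matrix.trace, Matrix.diag_apply, Matrix.mul_apply (M := Matrix.diagonal a * _),
          Matrix.diagonal_mul, ent]
      rw [this, sq]
      simp only [Finset.sum_mul]
      refine Finset.sum_congr rfl fun i _ => Finset.sum_congr rfl fun j _ => ?_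
      simp only [Finset.mul_sum]
      refine Finset.sum_congr rfl fun k _ => Finset.sum_congr rfl fun l _ => ?_
      ring
    simp only [hp]
    rw [integral_finsetSum _ fun i _ => integrable_finsetSum _ fun j _ =>
      integrable_finsetSum _ fun k _ => integrable_finsetSum _ fun l _ => i4 i j k l]
    refine Finset.sum_congr rfl fun i _ => ?_
    rw [integral_finsetSum _ fun j _ =>
      integrable_finsetSum _ fun k _ => integrable_finsetSum _ fun l _ => i4 i j k l]
    refine Finset.sum_congr rfl fun j _ => ?_
    rw [integral_finsetSum _ fun k _ => integrable_finsetSum _ fun l _ => i4 i j k l]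
    refine Finset.sum_congr rfl fun k _ => ?_
    rw [integral_finsetSum _ fun l _ => i4 i j k l]
    refine Finset.sum_congr rfl fun l _ => ?_
    rw [integral_const_mul, E4]
  rw [hint]
  refine (Finset.sum_le_sum fun i _ => Finset.sum_le_sum fun j _ => Finset.sum_le_sum fun k _ =>
    Finset.sum_le_sum fun l _ => term_le μ hn a i j k l).trans (le_of_eq ?_)
  have hs : ∑ i, ∑ k, a i ^ 2 * a k ^ 2 = (n : ℝ) * n := by
    rw [← ha, Finset.sum_mul_sum]
  simp only [← Finset.mul_sum, Finset.sum_add_distrib]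
  have s1 : ∑ i, ∑ j, ∑ k, ∑ l,
      (if j = i then (if l = k then a i ^ 2 * a k ^ 2 else 0) else 0) = (n : ℝ) * n := by
    rw [← hs]
    refine Finset.sum_congr rfl fun i _ => ?_
    rw [Finset.sum_eq_single i (by intro j _ hj; simp [hj]) (by simp)]
    simp
  have s2 : ∑ i, ∑ j, ∑ k, ∑ l,
      (if k = i then (if l = j then a i ^ 2 * a j ^ 2 else 0) else 0) = (n : ℝ) * n := by
    rw [← hs]
    refine Finset.sum_congr rfl fun i _ => Finset.sum_congr rfl fun j _ => ?_
    rw [Finset.sum_eq_single i (by intro j _ hj; simp [hj]) (by simp)]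
    simp
  have s3 : ∑ i, ∑ j, ∑ k, ∑ l,
      (if l = i then (if k = j then a i ^ 2 * a j ^ 2 else 0) else 0) = (n : ℝ) * n := by
    rw [← hs]
    refine Finset.sum_congr rfl fun i _ => Finset.sum_congr rfl fun j _ => ?_
    simp
  rw [s1, s2, s3]
  have hn' : (2 : ℝ) ≤ n := by exact_mod_cast hn
  have a1 : (n : ℝ) ≠ 0 := by positivity
  have a2 : (n : ℝ) - 1 ≠ 0 := by linarith
  have a3 : (n : ℝ) + 2 ≠ 0 := by positivity
  field_simp
  ring
end
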